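/- arXiv:2310.13497 — 2 statements merged into one kernel-verified Lean document; each statement's English description precedes it below -/
import Mathlib

section
/- For every σ ∈ (0,1/2) there exist b ∈ (1/2,1), b′ ∈ (b−1,0) and C > 0 such that for all Schwartz functions u₁, u₂, u₃, u₄ on ℝ²: ‖ |∇|(u₁u₂u₃u₄) ‖_{X^{σ,b′}} ≤ C ∏_{j=1}^4 ‖u_j‖_{X^{0,b}}, where |∇| denotes the spatial Fourier multiplier operator with symbol |ξ| (i.e., 𝓕_{t,x}(|∇|f)(τ,ξ) = |ξ|·𝓕_{t,x}f(τ,ξ)). -/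
open MeasureTheory

noncomputable section

/-- Spacetime Fourier transform on ℝ². -/
def FT2 (u : ℝ × ℝ → ℂ) (τ ξ : ℝ) : ℂ :=
  ∫ p : ℝ × ℝ, Complex.exp (-(Complex.I * ((p.1 * τ + p.2 * ξ : ℝ) : ℂ))) * u p

/-- Bourgain weight ⟨ξ⟩^{2s}⟨τ-ξ³⟩^{2b}, with ⟨x⟩ = (1+x²)^{1/2}. -/
def wgt (s b τ ξ : ℝ) : ℝ := (1 + ξ ^ 2) ^ s * (1 + (τ - ξ ^ 3) ^ 2) ^ b

/-- The Bourgain norm ‖u‖_{X^{s,b}}. -/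
def Xnorm (s b : ℝ) (u : ℝ × ℝ → ℂ) : ℝ :=
  Real.sqrt (∫ q : ℝ × ℝ, wgt s b q.1 q.2 * ‖FT2 u q.1 q.2‖ ^ 2)

/-- The weight `(1 + x²)^(-b)`, as an extended nonnegative real. -/
def japanese (b x : ℝ) : ENNReal := ENNReal.ofReal ((1 + x ^ 2) ^ (-b))

@[fun_prop]
lemma measurable_japanese (b : ℝ) : Measurable (japanese b) := by
  unfold japanese; fun_prop

lemma japanese_le_one {b : ℝ} (hb : 0 ≤ b) (x : ℝ) : japanese b x ≤ 1 := by
  unfold japanese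
  rw [ENNReal.ofReal_le_one]
  exact Real.rpow_le_one_of_one_le_of_nonpos (by nlinarith [sq_nonneg x]) (by linarith)

lemma lintegral_japanese_lt_top {b : ℝ} (hb : 1 / 2 < b) : ∫⁻ x, japanese b x < ⊤ := by
  have h := integrable_rpow_neg_one_add_norm_sq (E := ℝ) (μ := volume) (r := 2 * b)
    (by simp; linarith)
  have h2 := h.lintegral_lt_top
  refine lt_of_eq_of_lt (lintegral_congr fun x => ?_) h2
  simp only [japanese, Real.norm_eq_abs, sq_abs]
  congr 2; ring

lemma japanese_mul_japanese_le {b : ℝ} (hb : 0 ≤ b) (x y : ℝ) :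
    japanese b x * japanese b y ≤
      ENNReal.ofReal (4 ^ b) * japanese b (x + y) * (japanese b x + japanese b y) := by
  have key : ∀ x y : ℝ, x ^ 2 ≤ y ^ 2 →
      japanese b y ≤ ENNReal.ofReal (4 ^ b) * japanese b (x + y) := by
    intro x y hxy
    unfold japanese
    rw [← ENNReal.ofReal_mul (by positivity)]
    apply ENNReal.ofReal_le_ofReal
    have h1 : (1 + (x + y) ^ 2) ≤ 4 * (1 + y ^ 2) := by nlinarith [sq_nonneg (x - y)]
    have h2 : (1 + (x + y) ^ 2) ^ b ≤ 4 ^ b * (1 + y ^ 2) ^ b := by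
      rw [← Real.mul_rpow (by norm_num) (by positivity)]
      exact Real.rpow_le_rpow (by positivity) h1 hb
    rw [Real.rpow_neg (by positivity), Real.rpow_neg (by positivity), ← div_eq_mul_inv,
      le_div_iff₀ (by positivity), inv_mul_le_iff₀ (by positivity)]
    linarith
  rcases le_total (x ^ 2) (y ^ 2) with h | h
  · calc japanese b x * japanese b y
        ≤ japanese b x * (ENNReal.ofReal (4 ^ b) * japanese b (x + y)) := by
          gcongr; exact key x y h
      _ = ENNReal.ofReal (4 ^ b) * japanese b (x + y) * japanese b x := by ring
      _ ≤ _ := by gcongr; exact le_self_add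
  · calc japanese b x * japanese b y
        ≤ (ENNReal.ofReal (4 ^ b) * japanese b (y + x)) * japanese b y := by
          gcongr; exact key y x h
      _ = ENNReal.ofReal (4 ^ b) * japanese b (x + y) * japanese b y := by rw [add_comm y x]
      _ ≤ _ := by gcongr; exact le_add_self

lemma exists_lintegral_japanese_mul_le {b : ℝ} (hb : 1 / 2 < b) :
    ∃ C : ENNReal, C < ⊤ ∧ ∀ u v t : ℝ,
      ∫⁻ x, japanese b (x - u) * japanese b (t - x - v) ≤ C * japanese b (t - u - v) := by
  refine ⟨ENNReal.ofReal (4 ^ b) * (2 * ∫⁻ x, japanese b x), ?_, fun u v t => ?_⟩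
  · exact ENNReal.mul_lt_top ENNReal.ofReal_lt_top
      (ENNReal.mul_lt_top (by simp) (lintegral_japanese_lt_top hb))
  calc ∫⁻ x, japanese b (x - u) * japanese b (t - x - v)
      ≤ ∫⁻ x, ENNReal.ofReal (4 ^ b) * japanese b (t - u - v) *
          (japanese b (x - u) + japanese b (t - v - x)) := by
        refine lintegral_mono fun x => ?_
        convert japanese_mul_japanese_le (b := b) (by linarith) (x - u) (t - x - v) using 3
        · congr 1; ring
        · congr 1; ring
    _ = ENNReal.ofReal (4 ^ b) * japanese b (t - u - v) *
          ((∫⁻ x, japanese b (x - u)) + ∫⁻ x, japanese b (t - v - x)) := by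
        rw [lintegral_const_mul _ (by fun_prop), lintegral_add_left (by fun_prop)]
    _ = _ := by
        rw [lintegral_sub_right_eq_self (fun x => japanese b x), lintegral_sub_left_eq_self (fun x => japanese b x)]
        ring

/-- Change of variables bound for an injective differentiable function. -/
lemma lintegral_abs_deriv_mul_comp_le {s : Set ℝ} {φ φ' : ℝ → ℝ} (hs : MeasurableSet s)
    (hφ : ∀ x ∈ s, HasDerivAt φ (φ' x) x) (hinj : Set.InjOn φ s) (h : ℝ → ENNReal) :
    ∫⁻ x in s, ENNReal.ofReal |φ' x| * h (φ x) ≤ ∫⁻ y, h y := by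
  rw [← lintegral_image_eq_lintegral_abs_deriv_mul hs
    (fun x hx => (hφ x hx).hasDerivWithinAt) hinj h]
  exact setLIntegral_le_lintegral _ _

/-- Splitting the line into its positive and negative halves. -/
lemma lintegral_le_add_halves (f : ℝ → ENNReal) :
    ∫⁻ x, f x ≤ (∫⁻ x in Set.Ioi 0, f x) + ∫⁻ x in Set.Iio 0, f x := by
  rw [← lintegral_add_compl f (measurableSet_Ioi (a := (0 : ℝ))), Set.compl_Ioi,
    setLIntegral_congr (Iio_ae_eq_Iic (a := (0 : ℝ)) (μ := volume))]

lemma lintegral_quadratic_le (α r : ℝ) (h : ℝ → ENNReal) :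
    ∫⁻ d, ENNReal.ofReal |2 * r * d| * h (α + r * d ^ 2) ≤ 2 * ∫⁻ y, h y := by
  rcases eq_or_ne r 0 with rfl | hr
  · simp
  have hd : ∀ x : ℝ, HasDerivAt (fun d => α + r * d ^ 2) (2 * r * x) x := fun x => by
    refine (((hasDerivAt_pow 2 x).const_mul r).const_add α).congr_deriv ?_
    norm_num; ring
  refine (lintegral_le_add_halves _).trans ?_
  rw [two_mul (∫⁻ y, h y)]
  refine add_le_add
    (lintegral_abs_deriv_mul_comp_le measurableSet_Ioi (fun x _ => hd x) ?_ h)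
    (lintegral_abs_deriv_mul_comp_le measurableSet_Iio (fun x _ => hd x) ?_ h)
  · intro x hx y hy hxy
    simp only [add_right_inj, mul_eq_mul_left_iff, hr, or_false] at hxy
    exact (pow_left_inj₀ (le_of_lt hx) (le_of_lt hy) two_ne_zero).1 hxy
  · intro x hx y hy hxy
    simp only [add_right_inj, mul_eq_mul_left_iff, hr, or_false] at hxy
    simp only [Set.mem_Iio] at hx hy
    nlinarith [sq_eq_sq_iff_abs_eq_abs x y |>.1 hxy, abs_of_neg hx, abs_of_neg hy]

lemma lintegral_eq_mul_lintegral_comp_mul_left {a : ℝ} (ha : a ≠ 0) {f : ℝ → ENNReal}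
    (hf : Measurable f) : ∫⁻ x, f x = ENNReal.ofReal |a| * ∫⁻ x, f (a * x) := by
  conv_lhs => rw [← Real.smul_map_volume_mul_left ha]
  rw [lintegral_smul_measure, lintegral_map hf (by fun_prop)]
  rfl

lemma lintegral_abs_le_eq (R c : ℝ) :
    ∫⁻ x : ℝ, (if |x| ≤ R then ENNReal.ofReal c else 0) =
      ENNReal.ofReal c * ENNReal.ofReal (2 * R) := by
  have : (fun x : ℝ => if |x| ≤ R then ENNReal.ofReal c else 0) =
      (Set.Icc (-R) R).indicator fun _ => ENNReal.ofReal c := by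
    ext x
    simp [Set.indicator_apply, abs_le]
  rw [this, lintegral_indicator measurableSet_Icc, setLIntegral_const, Real.volume_Icc]
  congr 2; ring

/-- One-dimensional form of the bilinear estimate. -/
lemma exists_lintegral_pair_le {b : ℝ} (hb : 1 / 2 < b) :
    ∃ C : ENNReal, C < ⊤ ∧ ∀ t y : ℝ,
      ∫⁻ x, (if |x| ≤ 2 / 3 * |y - x| then
        ENNReal.ofReal (1 + (y - x) ^ 2) * japanese b (t - x ^ 3 - (y - x) ^ 3) else 0) ≤ C := by
  refine ⟨ENNReal.ofReal 2 * ENNReal.ofReal (2 * 1) + ENNReal.ofReal (6 / 5) * (2 * ∫⁻ x, japanese b x), ?_, ?_⟩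
  · have := lintegral_japanese_lt_top hb
    exact ENNReal.add_lt_top.2 ⟨ENNReal.mul_lt_top (by simp) (by simp),
      ENNReal.mul_lt_top (by simp) (ENNReal.mul_lt_top (by simp) this)⟩
  intro t y
  have hpt : ∀ x : ℝ, (if |x| ≤ 2 / 3 * |y - x| then
        ENNReal.ofReal (1 + (y - x) ^ 2) * japanese b (t - x ^ 3 - (y - x) ^ 3) else 0) ≤
      (if |x| ≤ 1 then ENNReal.ofReal 2 else 0) +
        ENNReal.ofReal (6 / 5) * (ENNReal.ofReal |2 * (-3 * y) * (x - y / 2)| *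
          japanese b (t - y ^ 3 / 4 + (-3 * y) * (x - y / 2) ^ 2)) := by
    intro x
    by_cases h : |x| ≤ 2 / 3 * |y - x|
    swap
    · simp [h]
    rw [if_pos h]
    rcases le_total |y - x| 1 with h1 | h1
    · refine le_trans ?_ le_self_add
      rw [if_pos (by linarith)]
      calc _ ≤ ENNReal.ofReal (1 + (y - x) ^ 2) * 1 := by
            gcongr; exact japanese_le_one (by linarith) _
        _ ≤ _ := by
            rw [mul_one]
            apply ENNReal.ofReal_le_ofReal
            nlinarith [sq_abs (y - x), abs_nonneg (y - x)]
    · refine le_trans ?_ le_add_self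
      rw [← mul_assoc, ← ENNReal.ofReal_mul (by norm_num)]
      have e : t - y ^ 3 / 4 + (-3 * y) * (x - y / 2) ^ 2 = t - x ^ 3 - (y - x) ^ 3 := by ring
      rw [e]
      gcongr
      have e2 : 2 * (-3 * y) * (x - y / 2) = 3 * ((y - x) ^ 2 - x ^ 2) := by ring
      have h3 : x ^ 2 ≤ 4 / 9 * (y - x) ^ 2 := by
        nlinarith [sq_abs x, sq_abs (y - x), abs_nonneg x]
      rw [e2, abs_of_nonneg (by nlinarith [sq_nonneg (y - x)])]
      nlinarith [sq_abs (y - x)]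
  refine (lintegral_mono hpt).trans ?_
  have hm : Measurable fun x : ℝ => if |x| ≤ 1 then ENNReal.ofReal 2 else 0 :=
    Measurable.ite (measurableSet_le (by fun_prop) (by fun_prop)) (by fun_prop) (by fun_prop)
  rw [lintegral_add_left hm, lintegral_abs_le_eq, lintegral_const_mul _ (by fun_prop)]
  gcongr
  rw [lintegral_sub_right_eq_self (fun x => ENNReal.ofReal |2 * (-3 * y) * x| *
    japanese b (t - y ^ 3 / 4 + (-3 * y) * x ^ 2))]
  exact lintegral_quadratic_le _ _ _

lemma lintegral_rpow_abs_lt_top {δ : ℝ} (hδ : 0 < δ) :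
    ∫⁻ r : ℝ, (if |r| ≤ 1 then ENNReal.ofReal (|r| ^ (δ - 1))
      else ENNReal.ofReal (|r| ^ (-1 - 2 * δ))) < ⊤ := by
  set ρ : ℝ → ENNReal := fun r => (if |r| ≤ 1 then ENNReal.ofReal (|r| ^ (δ - 1))
      else ENNReal.ofReal (|r| ^ (-1 - 2 * δ))) with hρ
  have hpos : ∫⁻ r in Set.Ioi (0 : ℝ), ρ r < ⊤ := by
    rw [← Set.Ioc_union_Ioi_eq_Ioi (zero_le_one (α := ℝ))]
    refine (lintegral_union_le _ _ _).trans_lt (ENNReal.add_lt_top.2 ⟨?_, ?_⟩)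
    · have h1 := (intervalIntegral.intervalIntegrable_rpow' (a := 0) (b := 1)
        (r := δ - 1) (by linarith)).1
      refine lt_of_eq_of_lt (setLIntegral_congr_fun measurableSet_Ioc fun x hx => ?_)
        h1.lintegral_lt_top
      simp only [hρ, abs_of_pos hx.1, if_pos hx.2]
    · have h1 := integrableOn_Ioi_rpow_of_lt (a := -1 - 2 * δ) (by linarith) zero_lt_one
      refine lt_of_eq_of_lt (setLIntegral_congr_fun measurableSet_Ioi fun x hx => ?_)
        h1.lintegral_lt_top
      have hx' : (1 : ℝ) < x := hx
      simp only [hρ, abs_of_pos (zero_lt_one.trans hx'), if_neg (not_le.2 hx')]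
  have hneg : ∫⁻ r in Set.Iio (0 : ℝ), ρ r = ∫⁻ r in Set.Ioi (0 : ℝ), ρ r := by
    have := (Measure.measurePreserving_neg (volume : Measure ℝ)).setLIntegral_comp_preimage_emb
      (MeasurableEquiv.neg ℝ).measurableEmbedding ρ (Set.Ioi 0)
    rw [← this]
    simp [hρ]
  refine (lintegral_le_add_halves ρ).trans_lt ?_
  rw [hneg]
  exact ENNReal.add_lt_top.2 ⟨hpos, hpos⟩

lemma lintegral_separated_inner_le {b δ : ℝ} (hb : 1 / 2 < b) (hδ : 0 < δ) (hδ' : δ < 1 / 2)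
    (A r : ℝ) (hr : r ≠ 0) :
    ∫⁻ d : ℝ, (if |r| ≤ 40 * |d| then
        ENNReal.ofReal ((1 + 400 * d ^ 2) ^ (1 / 2 - δ)) * japanese b (A + (-3 * r) * d ^ 2) else 0) ≤
      (42 + 30 * ∫⁻ x, japanese b x) * (if |r| ≤ 1 then ENNReal.ofReal (|r| ^ (δ - 1))
      else ENNReal.ofReal (|r| ^ (-1 - 2 * δ))) := by
  have hr0 : 0 < |r| := abs_pos.2 hr
  have hDsplit : ∀ d : ℝ, (1 + 400 * d ^ 2) ^ (1 / 2 - δ) =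
      √(1 + 400 * d ^ 2) * (1 + 400 * d ^ 2) ^ (-δ) := fun d => by
    rw [Real.sqrt_eq_rpow, ← Real.rpow_add (by positivity), sub_eq_add_neg]
  have hquad := lintegral_quadratic_le A (-3 * r) (japanese b)
  by_cases h1 : |r| ≤ 1
  · rw [if_pos h1]
    have hsq : (|r| ^ (-(1 / 2) : ℝ)) ^ 2 = 1 / |r| := by
      rw [← Real.rpow_natCast, ← Real.rpow_mul hr0.le]
      norm_num [Real.rpow_neg_one]
    have hpt : ∀ d : ℝ, (if |r| ≤ 40 * |d| then
        ENNReal.ofReal ((1 + 400 * d ^ 2) ^ (1 / 2 - δ)) * japanese b (A + (-3 * r) * d ^ 2) else 0) ≤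
        (if |d| ≤ |r| ^ (-(1 / 2) : ℝ) then ENNReal.ofReal (21 * |r| ^ (δ - 1 / 2)) else 0) +
        ENNReal.ofReal (5 * |r| ^ (δ - 1)) * (ENNReal.ofReal |2 * (-3 * r) * d| *
          japanese b (A + (-3 * r) * d ^ 2)) := by
      intro d
      split_ifs with h2 h3 h3
      · refine le_trans ?_ le_self_add
        refine (mul_le_mul_right (japanese_le_one (by linarith) _) _).trans ?_
        rw [mul_one]
        apply ENNReal.ofReal_le_ofReal
        have hd : d ^ 2 ≤ 1 / |r| := by
          rw [← sq_abs, ← hsq]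
          gcongr
        have hD : 1 + 400 * d ^ 2 ≤ 401 / |r| := by
          have : 1 ≤ 1 / |r| := by rw [le_div_iff₀ hr0]; linarith
          have e : 401 / |r| = 401 * (1 / |r|) := by ring
          rw [e]; linarith
        calc (1 + 400 * d ^ 2) ^ (1 / 2 - δ) ≤ (401 / |r|) ^ (1 / 2 - δ) :=
              Real.rpow_le_rpow (by positivity) hD (by linarith)
          _ = 401 ^ (1 / 2 - δ) * |r| ^ (δ - 1 / 2) := by
              rw [Real.div_rpow (by norm_num) hr0.le, div_eq_mul_inv, ← Real.rpow_neg hr0.le]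
              congr 2; ring
          _ ≤ 21 * |r| ^ (δ - 1 / 2) := by
              gcongr
              calc (401 : ℝ) ^ (1 / 2 - δ) ≤ 401 ^ (1 / 2 : ℝ) :=
                    Real.rpow_le_rpow_of_exponent_le (by norm_num) (by linarith)
                _ = √401 := (Real.sqrt_eq_rpow _).symm
                _ ≤ 21 := by rw [Real.sqrt_le_left (by norm_num)]; norm_num
      · refine le_trans ?_ le_add_self
        rw [← mul_assoc, ← ENNReal.ofReal_mul (by positivity)]
        gcongr
        push Not at h3
        have hd : 1 / |r| ≤ d ^ 2 := by
          rw [← sq_abs d, ← hsq]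
          gcongr
        have hd1 : 1 ≤ d ^ 2 := le_trans (by rw [le_div_iff₀ hr0]; linarith) hd
        rw [hDsplit]
        have hs : √(1 + 400 * d ^ 2) ≤ 21 * |d| := by
          rw [Real.sqrt_le_left (by positivity), mul_pow, sq_abs]
          linarith
        have hD : (1 + 400 * d ^ 2) ^ (-δ) ≤ |r| ^ δ := by
          calc (1 + 400 * d ^ 2) ^ (-δ) ≤ (1 / |r|) ^ (-δ) :=
                Real.rpow_le_rpow_of_nonpos (by positivity) (by linarith) (by linarith)
            _ = |r| ^ δ := by
                rw [one_div, Real.inv_rpow hr0.le, Real.rpow_neg hr0.le, inv_inv]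
        have e : |r| ^ δ = |r| ^ (δ - 1) * |r| := by
          rw [← Real.rpow_add_one hr0.ne']; congr 1; ring
        calc _ ≤ 21 * |d| * |r| ^ δ := by gcongr
          _ ≤ 30 * |d| * |r| ^ δ := by gcongr; norm_num
          _ = _ := by
            rw [e, abs_mul, abs_mul, abs_mul, abs_neg, abs_two, abs_of_pos (three_pos (α := ℝ))]
            ring
      · exact zero_le
      · exact zero_le
    refine (lintegral_mono hpt).trans ?_
    have hm : Measurable fun d : ℝ => if |d| ≤ |r| ^ (-(1 / 2) : ℝ) then
        ENNReal.ofReal (21 * |r| ^ (δ - 1 / 2)) else 0 :=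
      Measurable.ite (measurableSet_le (by fun_prop) (by fun_prop)) (by fun_prop) (by fun_prop)
    rw [lintegral_add_left hm, lintegral_abs_le_eq, lintegral_const_mul _ (by fun_prop),
      ← ENNReal.ofReal_mul (by positivity)]
    have e : 21 * |r| ^ (δ - 1 / 2) * (2 * |r| ^ (-(1 / 2) : ℝ)) = 42 * |r| ^ (δ - 1) := by
      have : |r| ^ (δ - 1) = |r| ^ (δ - 1 / 2) * |r| ^ (-(1 / 2) : ℝ) := by
        rw [← Real.rpow_add hr0]; congr 1; ring
      rw [this]; ring
    rw [e, ENNReal.ofReal_mul (by norm_num), ENNReal.ofReal_mul (by norm_num), add_mul]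
    refine add_le_add ?_ ?_
    · simp
    · calc _ ≤ ENNReal.ofReal 5 * ENNReal.ofReal (|r| ^ (δ - 1)) * (2 * ∫⁻ x, japanese b x) := by
            gcongr
        _ = 10 * (∫⁻ x, japanese b x) * ENNReal.ofReal (|r| ^ (δ - 1)) := by
            rw [show ENNReal.ofReal 5 = 5 by simp]; ring
        _ ≤ _ := by gcongr; norm_num
  · rw [if_neg h1]
    push Not at h1
    have hpt : ∀ d : ℝ, (if |r| ≤ 40 * |d| then
        ENNReal.ofReal ((1 + 400 * d ^ 2) ^ (1 / 2 - δ)) * japanese b (A + (-3 * r) * d ^ 2) else 0) ≤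
        ENNReal.ofReal (15 * |r| ^ (-1 - 2 * δ)) * (ENNReal.ofReal |2 * (-3 * r) * d| *
          japanese b (A + (-3 * r) * d ^ 2)) := by
      intro d
      split_ifs with h2
      · rw [← mul_assoc, ← ENNReal.ofReal_mul (by positivity)]
        gcongr
        have hrd : r ^ 2 ≤ 1600 * d ^ 2 := by
          nlinarith [sq_abs r, sq_abs d, abs_nonneg r, abs_nonneg d]
        have hr1 : 1 ≤ r ^ 2 := by nlinarith [sq_abs r]
        rw [hDsplit]
        have hs : √(1 + 400 * d ^ 2) ≤ 45 * |d| := by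
          rw [Real.sqrt_le_left (by positivity), mul_pow, sq_abs]
          linarith
        have hD : (1 + 400 * d ^ 2) ^ (-δ) ≤ 2 * |r| ^ (-2 * δ) := by
          calc (1 + 400 * d ^ 2) ^ (-δ) ≤ ((|r| / 2) ^ 2) ^ (-δ) := by
                refine Real.rpow_le_rpow_of_nonpos (by positivity) ?_ (by linarith)
                rw [div_pow, sq_abs]; linarith
            _ = 2 ^ (2 * δ) * |r| ^ (-2 * δ) := by
                rw [← Real.rpow_natCast, ← Real.rpow_mul (by positivity),
                  Real.div_rpow hr0.le (by norm_num), div_eq_mul_inv,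
                  ← Real.rpow_neg (by norm_num), mul_comm]
                congr 2 <;> push_cast <;> ring
            _ ≤ 2 * |r| ^ (-2 * δ) := by
                gcongr
                calc (2 : ℝ) ^ (2 * δ) ≤ 2 ^ (1 : ℝ) :=
                      Real.rpow_le_rpow_of_exponent_le (by norm_num) (by linarith)
                  _ = 2 := Real.rpow_one 2
        have e : |r| ^ (-2 * δ) = |r| ^ (-1 - 2 * δ) * |r| := by
          rw [← Real.rpow_add_one hr0.ne']; congr 1; ring
        calc _ ≤ 45 * |d| * (2 * |r| ^ (-2 * δ)) := by gcongr
          _ = _ := by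
            rw [e, abs_mul, abs_mul, abs_mul, abs_neg, abs_two, abs_of_pos (three_pos (α := ℝ))]
            ring
      · exact zero_le
    refine (lintegral_mono hpt).trans ?_
    rw [lintegral_const_mul _ (by fun_prop), ENNReal.ofReal_mul (by norm_num)]
    calc _ ≤ ENNReal.ofReal 15 * ENNReal.ofReal (|r| ^ (-1 - 2 * δ)) * (2 * ∫⁻ x, japanese b x) := by
            gcongr
        _ = 30 * (∫⁻ x, japanese b x) * ENNReal.ofReal (|r| ^ (-1 - 2 * δ)) := by
            rw [show ENNReal.ofReal 15 = 15 by simp]; ring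
        _ ≤ _ := by gcongr; exact le_add_self

lemma exists_lintegral_separated_le {b δ : ℝ} (hb : 1 / 2 < b) (hδ : 0 < δ) (hδ' : δ < 1 / 2) :
    ∃ C : ENNReal, C < ⊤ ∧ ∀ t y : ℝ, ∫⁻ x₁, ∫⁻ x₂,
      (if |x₁| ≤ |y - x₁ - x₂| ∧ |x₂| ≤ |y - x₁ - x₂| ∧
          |y - x₁ - x₂| ≤ 10 * |y - x₁ - x₂ - x₂| then
        ENNReal.ofReal ((1 + (y - x₁ - x₂) ^ 2) ^ (1 / 2 - δ)) *
          japanese b (t - x₁ ^ 3 - x₂ ^ 3 - (y - x₁ - x₂) ^ 3) else 0) ≤ C := by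
  refine ⟨(42 + 30 * ∫⁻ x, japanese b x) * ∫⁻ r : ℝ, (if |r| ≤ 1 then
    ENNReal.ofReal (|r| ^ (δ - 1)) else ENNReal.ofReal (|r| ^ (-1 - 2 * δ))), ?_, fun t y => ?_⟩
  · refine ENNReal.mul_lt_top (ENNReal.add_lt_top.2 ⟨by simp, ?_⟩) (lintegral_rpow_abs_lt_top hδ)
    exact ENNReal.mul_lt_top (by simp) (lintegral_japanese_lt_top hb)
  have hm : Measurable fun r : ℝ => (if |r| ≤ 1 then
      ENNReal.ofReal (|r| ^ (δ - 1)) else ENNReal.ofReal (|r| ^ (-1 - 2 * δ))) :=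
    Measurable.ite (measurableSet_le (by fun_prop) (by fun_prop)) (by fun_prop) (by fun_prop)
  rw [← lintegral_const_mul _ hm, ← lintegral_sub_left_eq_self _ y]
  refine lintegral_mono_ae ?_
  have hne : ∀ᵐ r : ℝ, r ≠ 0 := by simp [ae_iff]
  filter_upwards [hne] with r hr
  refine le_trans ?_ (lintegral_separated_inner_le hb hδ hδ'
    (t - (y - r) ^ 3 - r ^ 3 / 4) r hr)
  rw [← lintegral_sub_left_eq_self _ (r / 2)]
  refine lintegral_mono fun d => ?_
  have e1 : y - (y - r) - (r / 2 - d) = r / 2 + d := by ring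
  have e2 : r / 2 + d - (r / 2 - d) = 2 * d := by ring
  have e3 : t - (y - r) ^ 3 - (r / 2 - d) ^ 3 - (r / 2 + d) ^ 3 =
    t - (y - r) ^ 3 - r ^ 3 / 4 + -3 * r * d ^ 2 := by ring
  simp only [e1, e2, e3]
  split_ifs with h h' h'
  · obtain ⟨-, -, h3⟩ := h
    rw [abs_mul, abs_two] at h3
    gcongr
    nlinarith [sq_abs (r / 2 + d), sq_abs d, abs_nonneg (r / 2 + d), abs_nonneg d]
  · exfalso
    apply h'
    obtain ⟨-, h2, h3⟩ := h
    rw [abs_mul, abs_two] at h3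
    have : |r| ≤ |r / 2 - d| + |r / 2 + d| := by
      calc |r| = |(r / 2 - d) + (r / 2 + d)| := by congr 1; ring
        _ ≤ _ := abs_add_le _ _
    linarith
  · exact zero_le
  · exact le_rfl

lemma lintegral_near_radial_le (b m t₀ t : ℝ) (hm : m ≠ 0) (ht : |t| ≤ 1) :
    ∫⁻ ρ : ℝ, (if |ρ| ≤ |m| / 5 then ENNReal.ofReal |ρ| *
      japanese b (t₀ - 6 * m * ρ ^ 2 * (1 + t + t ^ 2) + 3 * ρ ^ 3 * (t * (1 + t))) else 0) ≤
      ENNReal.ofReal (1 / |m|) * (2 * ∫⁻ x, japanese b x) := by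
  have hm0 : 0 < |m| := abs_pos.2 hm
  obtain ⟨ht1, ht2⟩ := abs_le.1 ht
  set A := 1 + t + t ^ 2 with hA
  set B := t * (1 + t) with hB
  have hA1 : 3 / 4 ≤ A := by nlinarith [sq_nonneg (t + 1 / 2)]
  have hB1 : |B| ≤ 2 := abs_le.2 ⟨by nlinarith [sq_nonneg (t + 1 / 2)], by nlinarith⟩
  set φ : ℝ → ℝ := fun ρ => t₀ - 6 * m * ρ ^ 2 * A + 3 * ρ ^ 3 * B with hφ
  set φ' : ℝ → ℝ := fun ρ => -3 * ρ * (4 * m * A - 3 * B * ρ) with hφ'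
  have hd : ∀ ρ, HasDerivAt φ (φ' ρ) ρ := fun ρ => by
    have h1 := (((hasDerivAt_pow 2 ρ).const_mul (6 * m)).mul_const A).const_sub t₀
    have h2 := ((hasDerivAt_pow 3 ρ).const_mul 3).mul_const B
    refine (h1.add h2).congr_deriv ?_
    simp only [hφ']
    norm_num; ring
  have hA4 : ∀ c : ℝ, 0 ≤ c → c * (3 / 4) * |m| ≤ |c * m * A| := fun c hc => by
    rw [abs_mul, abs_mul, abs_of_nonneg hc, abs_of_nonneg (by linarith : (0 : ℝ) ≤ A)]
    nlinarith [mul_nonneg hc hm0.le]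
  have hlow : ∀ ρ, |ρ| ≤ |m| / 5 → |ρ| ≤ 1 / |m| * |φ' ρ| := by
    intro ρ hρ
    have h1 : |m| ≤ |4 * m * A - 3 * B * ρ| := by
      have h2 := abs_sub_abs_le_abs_sub (4 * m * A) (3 * B * ρ)
      have h3 : |3 * B * ρ| ≤ 6 * (|m| / 5) := by
        rw [abs_mul, abs_mul, abs_of_pos (three_pos (α := ℝ))]
        nlinarith [abs_nonneg B, abs_nonneg ρ]
      have h4 := hA4 4 (by norm_num)
      linarith
    rw [one_div, ← div_eq_inv_mul, le_div_iff₀ hm0]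
    simp only [hφ']
    rw [abs_mul, abs_mul, abs_neg, abs_of_pos (three_pos (α := ℝ))]
    nlinarith [abs_nonneg ρ, mul_le_mul_of_nonneg_left h1 (abs_nonneg ρ)]
  have hinj : ∀ x y, |x| ≤ |m| / 5 → |y| ≤ |m| / 5 → 0 < x * y → φ x = φ y → x = y := by
    intro x y hx hy hxy h
    by_contra hne
    have h1 : 6 * m * A * (x + y) = 3 * B * (x ^ 2 + x * y + y ^ 2) := by
      have : (x - y) * (6 * m * A * (x + y) - 3 * B * (x ^ 2 + x * y + y ^ 2)) = 0 := by
        simp only [hφ] at h; linear_combination -h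
      rcases mul_eq_zero.1 this with h | h
      · exact absurd (sub_eq_zero.1 h) hne
      · linarith
    have hs : 0 < |x + y| := abs_pos.2 fun h0 => by nlinarith [sq_nonneg (x + y), sq_nonneg x]
    have h2 : 6 * (3 / 4) * |m| * |x + y| ≤ |6 * m * A * (x + y)| := by
      rw [abs_mul]
      gcongr
      exact hA4 6 (by norm_num)
    have h3 : |3 * B * (x ^ 2 + x * y + y ^ 2)| ≤ 6 * |x + y| ^ 2 := by
      rw [abs_mul, abs_mul, abs_of_pos (three_pos (α := ℝ)), sq_abs,
        abs_of_nonneg (by nlinarith [sq_nonneg x, sq_nonneg y] : (0 : ℝ) ≤ x ^ 2 + x * y + y ^ 2)]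
      have : 0 ≤ x ^ 2 + x * y + y ^ 2 := by nlinarith [sq_nonneg x, sq_nonneg y]
      nlinarith [abs_nonneg B]
    have h4 : |x + y| ≤ 2 * (|m| / 5) := (abs_add_le _ _).trans (by linarith)
    rw [h1] at h2
    nlinarith [mul_le_mul_of_nonneg_right h4 hs.le, mul_pos hm0 hs]
  have half : ∀ s : Set ℝ, MeasurableSet s → (∀ x ∈ s, ∀ y ∈ s, 0 < x * y) →
      ∫⁻ ρ in s, (if |ρ| ≤ |m| / 5 then ENNReal.ofReal |ρ| * japanese b (φ ρ) else 0) ≤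
        ENNReal.ofReal (1 / |m|) * ∫⁻ x, japanese b x := by
    intro s hs hsgn
    set u : Set ℝ := {ρ | |ρ| ≤ |m| / 5} with hu
    have hum : MeasurableSet u := measurableSet_le (by fun_prop) (by fun_prop)
    calc _ = ∫⁻ ρ in s, u.indicator (fun ρ => ENNReal.ofReal |ρ| * japanese b (φ ρ)) ρ := by
          simp only [Set.indicator_apply, hu, Set.mem_ofPred_eq]
      _ = ∫⁻ ρ in u ∩ s, ENNReal.ofReal |ρ| * japanese b (φ ρ) := by
          rw [lintegral_indicator hum, Measure.restrict_restrict hum]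
      _ ≤ ∫⁻ ρ in u ∩ s, ENNReal.ofReal (1 / |m|) *
            (ENNReal.ofReal |φ' ρ| * japanese b (φ ρ)) := by
          refine setLIntegral_mono' (hum.inter hs) fun ρ hρ => ?_
          rw [← mul_assoc, ← ENNReal.ofReal_mul (by positivity)]
          gcongr
          exact hlow ρ hρ.1
      _ = ENNReal.ofReal (1 / |m|) * ∫⁻ ρ in u ∩ s,
            ENNReal.ofReal |φ' ρ| * japanese b (φ ρ) := by
          rw [lintegral_const_mul]; fun_prop
      _ ≤ _ := mul_le_mul' le_rfl (lintegral_abs_deriv_mul_comp_le (hum.inter hs)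
            (fun x _ => hd x) (fun x hx y hy => hinj x y hx.1 hy.1 (hsgn x hx.2 y hy.2)) _)
  refine (lintegral_le_add_halves _).trans ?_
  rw [two_mul (∫⁻ x, japanese b x), mul_add]
  refine add_le_add (half _ measurableSet_Ioi fun x hx y hy => mul_pos hx hy)
    (half _ measurableSet_Iio fun x hx y hy => mul_pos_of_neg_of_neg hx hy)

lemma lintegral_near_sector_le (b m t₀ : ℝ) (hm : m ≠ 0) :
    ∫⁻ x : ℝ, ∫⁻ y : ℝ, (if |x| ≤ |m| / 5 ∧ |y| ≤ |x| then
      japanese b (t₀ - 6 * m * (x ^ 2 + x * y + y ^ 2) + 3 * x * y * (x + y)) else 0) ≤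
      ENNReal.ofReal (1 / |m|) * (4 * ∫⁻ x, japanese b x) := by
  set g : ℝ → ℝ → ENNReal := fun x s => if |x| ≤ |m| / 5 ∧ |s| ≤ 1 then ENNReal.ofReal |x| *
      japanese b (t₀ - 6 * m * x ^ 2 * (1 + s + s ^ 2) + 3 * x ^ 3 * (s * (1 + s))) else 0 with hg
  have hgm : Measurable (Function.uncurry g) := by
    simp only [hg, Function.uncurry_def]
    exact Measurable.ite ((measurableSet_le (by fun_prop : Measurable fun p : ℝ × ℝ => |p.1|)
      measurable_const).inter (measurableSet_le (by fun_prop : Measurable fun p : ℝ × ℝ => |p.2|)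
      measurable_const)) (by fun_prop) (by fun_prop)
  calc _ ≤ ∫⁻ x, ∫⁻ s, g x s := by
        refine lintegral_mono_ae ?_
        have hne : ∀ᵐ r : ℝ, r ≠ 0 := by simp [ae_iff]
        filter_upwards [hne] with x hx
        rw [lintegral_eq_mul_lintegral_comp_mul_left hx, ← lintegral_const_mul']
        · refine lintegral_mono fun s => ?_
          have h1 : |x * s| ≤ |x| ↔ |s| ≤ 1 := by
            rw [abs_mul]; exact mul_le_iff_le_one_right (abs_pos.2 hx)
          simp only [hg, h1, mul_ite, mul_zero]
          refine le_of_eq ?_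
          congr 3
          ring
        · simp
        · exact Measurable.ite ((MeasurableSet.const _).inter (measurableSet_le
            (by fun_prop : Measurable fun y : ℝ => |y|) measurable_const))
            (by fun_prop) (by fun_prop)
    _ = ∫⁻ s, ∫⁻ x, g x s := lintegral_lintegral_swap hgm.aemeasurable
    _ ≤ ∫⁻ s : ℝ, (if |s| ≤ 1 then ENNReal.ofReal 1 else 0) *
          (ENNReal.ofReal (1 / |m|) * (2 * ∫⁻ x, japanese b x)) := by
        refine lintegral_mono fun s => ?_
        by_cases hs : |s| ≤ 1
        · simp only [hg, hs, and_true, if_true, ENNReal.ofReal_one, one_mul]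
          exact lintegral_near_radial_le b m t₀ s hm hs
        · simp [hg, hs]
    _ = _ := by
        rw [lintegral_mul_const, lintegral_abs_le_eq]
        · simp; ring
        · exact Measurable.ite (measurableSet_le (by fun_prop) (by fun_prop))
            (by fun_prop) (by fun_prop)

lemma near_diagonal {x₁ x₂ x₃ m : ℝ} (hm : x₁ + x₂ + x₃ = 3 * m) (h1 : 10 * |x₃ - x₁| ≤ |x₃|)
    (h2 : 10 * |x₃ - x₂| ≤ |x₃|) :
    |x₁ - m| ≤ |m| / 5 ∧ |x₂ - m| ≤ |m| / 5 ∧ |x₃| ≤ 15 / 14 * |m| := by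
  have e1 : x₁ - m = -(2 / 3) * (x₃ - x₁) + 1 / 3 * (x₃ - x₂) := by linarith
  have e2 : x₂ - m = -(2 / 3) * (x₃ - x₂) + 1 / 3 * (x₃ - x₁) := by linarith
  have e3 : x₃ = m + (1 / 3 * (x₃ - x₁) + 1 / 3 * (x₃ - x₂)) := by linarith
  have a3 : |x₃| ≤ |m| + (1 / 3 * |x₃ - x₁| + 1 / 3 * |x₃ - x₂|) := by
    calc |x₃| = |m + (1 / 3 * (x₃ - x₁) + 1 / 3 * (x₃ - x₂))| := by rw [← e3]
      _ ≤ |m| + (|1 / 3 * (x₃ - x₁)| + |1 / 3 * (x₃ - x₂)|) :=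
          (abs_add_le _ _).trans (add_le_add le_rfl (abs_add_le _ _))
      _ = _ := by rw [abs_mul, abs_mul, abs_of_pos (by norm_num : (0 : ℝ) < 1 / 3)]
  have a1 : |x₁ - m| ≤ 2 / 3 * |x₃ - x₁| + 1 / 3 * |x₃ - x₂| := by
    rw [e1]
    refine (abs_add_le _ _).trans (le_of_eq ?_)
    rw [abs_mul, abs_mul, abs_neg, abs_of_pos (by norm_num : (0 : ℝ) < 1 / 3),
      abs_of_pos (by norm_num : (0 : ℝ) < 2 / 3)]
  have a2 : |x₂ - m| ≤ 2 / 3 * |x₃ - x₂| + 1 / 3 * |x₃ - x₁| := by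
    rw [e2]
    refine (abs_add_le _ _).trans (le_of_eq ?_)
    rw [abs_mul, abs_mul, abs_neg, abs_of_pos (by norm_num : (0 : ℝ) < 1 / 3),
      abs_of_pos (by norm_num : (0 : ℝ) < 2 / 3)]
  have := abs_nonneg m
  refine ⟨?_, ?_, ?_⟩ <;> linarith

lemma exists_lintegral_triple_le {b δ : ℝ} (hb : 1 / 2 < b) (hδ : 0 < δ) (hδ' : δ < 1 / 2) :
    ∃ C : ENNReal, C < ⊤ ∧ ∀ t y : ℝ, ∫⁻ x₁, ∫⁻ x₂,
      (if |x₁| ≤ |y - x₁ - x₂| ∧ |x₂| ≤ |y - x₁ - x₂| then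
        ENNReal.ofReal ((1 + (y - x₁ - x₂) ^ 2) ^ (1 / 2 - δ)) *
          japanese b (t - x₁ ^ 3 - x₂ ^ 3 - (y - x₁ - x₂) ^ 3) else 0) ≤ C := by
  obtain ⟨C, hC, hA⟩ := exists_lintegral_separated_le hb hδ hδ'
  set J := ∫⁻ x, japanese b x with hJ
  have hJt : J < ⊤ := lintegral_japanese_lt_top hb
  have c4 : (4 : ENNReal) < ⊤ := by simp
  refine ⟨C + C + (2 * (4 * J)) + (2 * (4 * J)) + 4 * 16, ?_, fun t y => ?_⟩
  · simp only [ENNReal.add_lt_top]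
    refine ⟨⟨⟨⟨hC, hC⟩, ?_⟩, ?_⟩, ?_⟩
    · exact ENNReal.mul_lt_top (by simp) (ENNReal.mul_lt_top c4 hJt)
    · exact ENNReal.mul_lt_top (by simp) (ENNReal.mul_lt_top c4 hJt)
    · exact ENNReal.mul_lt_top c4 (by simp)
  set m := y / 3 with hm
  have hy : y = 3 * m := by rw [hm]; ring
  set A : ℝ × ℝ → ENNReal := fun p => if |p.1| ≤ |y - p.1 - p.2| ∧ |p.2| ≤ |y - p.1 - p.2| ∧
          |y - p.1 - p.2| ≤ 10 * |y - p.1 - p.2 - p.2| then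
        ENNReal.ofReal ((1 + (y - p.1 - p.2) ^ 2) ^ (1 / 2 - δ)) *
          japanese b (t - p.1 ^ 3 - p.2 ^ 3 - (y - p.1 - p.2) ^ 3) else 0 with hAdef
  set N : ℝ × ℝ → ENNReal := fun p => ENNReal.ofReal (2 * |m|) *
      (if |p.1 - m| ≤ |m| / 5 ∧ |p.2 - m| ≤ |p.1 - m| then
      japanese b (t - 3 * m ^ 3 - 6 * m * ((p.1 - m) ^ 2 + (p.1 - m) * (p.2 - m) + (p.2 - m) ^ 2)
        + 3 * (p.1 - m) * (p.2 - m) * ((p.1 - m) + (p.2 - m))) else 0) with hNdef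
  set S : ℝ × ℝ → ENNReal := fun p =>
    4 * ((if |p.1| ≤ 2 then ENNReal.ofReal 1 else 0) *
      (if |p.2| ≤ 2 then ENNReal.ofReal 1 else 0)) with hSdef
  have mle : ∀ f g : ℝ × ℝ → ℝ, Measurable f → Measurable g → MeasurableSet {p | f p ≤ g p} :=
    fun f g hf hg => measurableSet_le hf hg
  have mA : Measurable A := by
    refine Measurable.ite ((mle (fun p => |p.1|) (fun p => |y - p.1 - p.2|) (by fun_prop)
      (by fun_prop)).inter ((mle (fun p => |p.2|) (fun p => |y - p.1 - p.2|) (by fun_prop)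
      (by fun_prop)).inter (mle (fun p => |y - p.1 - p.2|) (fun p => 10 * |y - p.1 - p.2 - p.2|)
      (by fun_prop) (by fun_prop)))) (by fun_prop) (by fun_prop)
  have mN : Measurable N := by
    refine Measurable.const_mul (Measurable.ite ((mle (fun p => |p.1 - m|) (fun p => |m| / 5)
      (by fun_prop) (by fun_prop)).inter (mle (fun p => |p.2 - m|) (fun p => |p.1 - m|)
      (by fun_prop) (by fun_prop))) (by fun_prop) (by fun_prop)) _
  have mS : Measurable S := by
    refine Measurable.const_mul (Measurable.mul
      (Measurable.ite (mle (fun p => |p.1|) (fun p => 2) (by fun_prop) (by fun_prop))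
        (by fun_prop) (by fun_prop))
      (Measurable.ite (mle (fun p => |p.2|) (fun p => 2) (by fun_prop) (by fun_prop))
        (by fun_prop) (by fun_prop))) _
  have mA' : Measurable fun p : ℝ × ℝ => A p.swap := mA.comp measurable_swap
  have mN' : Measurable fun p : ℝ × ℝ => N p.swap := mN.comp measurable_swap
  have iA : ∫⁻ p, A p ≤ C := by
    rw [Measure.volume_eq_prod, lintegral_prod _ mA.aemeasurable]; exact hA t y
  have iA' : ∫⁻ p : ℝ × ℝ, A p.swap ≤ C := by
    rw [Measure.volume_eq_prod, lintegral_prod_symm _ mA'.aemeasurable]; exact hA t y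
  have iN0 : ∫⁻ x, ∫⁻ y, N (x, y) ≤ 2 * (4 * J) := by
    rcases eq_or_ne m 0 with h0 | h0
    · simp [hNdef, h0]
    have h1 : ENNReal.ofReal (2 * |m|) * (ENNReal.ofReal (1 / |m|) * (4 * J)) = 2 * (4 * J) := by
      have : 0 < |m| := abs_pos.2 h0
      rw [← mul_assoc, ← ENNReal.ofReal_mul (by positivity)]
      congr 1
      rw [show 2 * |m| * (1 / |m|) = 2 by field_simp]
      simp
    rw [← h1]
    simp only [hNdef]
    have h2 : ∀ x : ℝ, ∀ f : ℝ → ENNReal, ∫⁻ y, ENNReal.ofReal (2 * |m|) * f y =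
        ENNReal.ofReal (2 * |m|) * ∫⁻ y, f y := fun x f => lintegral_const_mul' _ _ ENNReal.ofReal_ne_top
    rw [lintegral_congr fun x => h2 x _, h2 0]
    refine mul_le_mul' le_rfl ?_
    refine le_trans (le_of_eq ?_) (lintegral_near_sector_le b m (t - 3 * m ^ 3) h0)
    set g : ℝ → ℝ → ENNReal := fun x y => if |x| ≤ |m| / 5 ∧ |y| ≤ |x| then
      japanese b (t - 3 * m ^ 3 - 6 * m * (x ^ 2 + x * y + y ^ 2) + 3 * x * y * (x + y)) else 0
    exact (lintegral_congr fun x => lintegral_sub_right_eq_self (g (x - m)) m).trans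
      (lintegral_sub_right_eq_self (fun x => ∫⁻ y, g x y) m)
  have iN : ∫⁻ p, N p ≤ 2 * (4 * J) := by
    rw [Measure.volume_eq_prod, lintegral_prod _ mN.aemeasurable]; exact iN0
  have iN' : ∫⁻ p : ℝ × ℝ, N p.swap ≤ 2 * (4 * J) := by
    rw [Measure.volume_eq_prod, lintegral_prod_symm _ mN'.aemeasurable]; exact iN0
  have iS : ∫⁻ p, S p ≤ 4 * 16 := by
    simp only [hSdef]
    rw [lintegral_const_mul' _ _ (by simp), Measure.volume_eq_prod,
      lintegral_prod_mul (f := fun x : ℝ => if |x| ≤ 2 then ENNReal.ofReal 1 else 0)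
        (g := fun x : ℝ => if |x| ≤ 2 then ENNReal.ofReal 1 else 0)]
    · rw [lintegral_abs_le_eq]
      refine mul_le_mul' le_rfl (le_of_eq ?_)
      rw [← ENNReal.ofReal_mul (by norm_num)]
      norm_num
    · exact (Measurable.ite (measurableSet_le (by fun_prop) (by fun_prop))
        (by fun_prop) (by fun_prop)).aemeasurable
    · exact (Measurable.ite (measurableSet_le (by fun_prop) (by fun_prop))
        (by fun_prop) (by fun_prop)).aemeasurable
  calc _ ≤ ∫⁻ x₁, ∫⁻ x₂, (A (x₁, x₂) + A (x₁, x₂).swap + N (x₁, x₂) + N (x₁, x₂).swap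
          + S (x₁, x₂)) := by
        refine lintegral_mono fun x₁ => lintegral_mono fun x₂ => ?_
        dsimp only
        split_ifs with h
        swap
        · exact zero_le
        obtain ⟨h1, h2⟩ := h
        have es : y - x₂ - x₁ = y - x₁ - x₂ := by ring
        by_cases c1 : |y - x₁ - x₂| ≤ 10 * |y - x₁ - x₂ - x₂|
        · refine le_trans (le_of_eq ?_) (le_trans (le_trans (le_trans le_self_add le_self_add)
            le_self_add) le_self_add)
          simp only [hAdef, h1, h2, c1, and_self, if_true]
        by_cases c2 : |y - x₁ - x₂| ≤ 10 * |y - x₁ - x₂ - x₁|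
        · refine le_trans (le_of_eq ?_) (le_trans (le_trans (le_trans le_add_self le_self_add)
            le_self_add) le_self_add)
          simp only [hAdef, Prod.swap_prod_mk, es, h1, h2, c2, and_self, if_true]
          congr 2; ring
        push Not at c1 c2
        obtain ⟨n1, n2, n3⟩ := near_diagonal (x₁ := x₁) (x₂ := x₂) (x₃ := y - x₁ - x₂) (m := m)
          (by rw [hy]; ring) c2.le c1.le
        have hr : (1 + (y - x₁ - x₂) ^ 2) ^ (1 / 2 - δ) ≤ Real.sqrt (1 + (y - x₁ - x₂) ^ 2) := by
          rw [Real.sqrt_eq_rpow]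
          exact Real.rpow_le_rpow_of_exponent_le (by nlinarith [sq_nonneg (y - x₁ - x₂)])
            (by linarith)
        have n4 : (y - x₁ - x₂) ^ 2 ≤ (15 / 14 * |m|) ^ 2 := sq_le_sq' (by
          linarith [neg_abs_le (y - x₁ - x₂)]) ((le_abs_self _).trans n3)
        rw [mul_pow, sq_abs] at n4
        rcases le_total |m| 1 with hm1 | hm1
        · have hm2 : m ^ 2 ≤ 1 := by rw [← sq_abs]; nlinarith [abs_nonneg m]
          have k1 : |x₁| ≤ 2 := by linarith
          have k2 : |x₂| ≤ 2 := by linarith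
          refine le_trans ?_ le_add_self
          simp only [hSdef, k1, k2, if_true, ENNReal.ofReal_one, mul_one]
          refine (mul_le_mul' (ENNReal.ofReal_le_ofReal (hr.trans ?_))
            (japanese_le_one (by linarith) _)).trans (?_ : ENNReal.ofReal 4 * 1 ≤ _)
          · rw [Real.sqrt_le_left (by norm_num)]; linarith
          · simp
        · have hm2 : 1 ≤ m ^ 2 := by rw [← sq_abs]; nlinarith [abs_nonneg m]
          have hr2 : (1 + (y - x₁ - x₂) ^ 2) ^ (1 / 2 - δ) ≤ 2 * |m| := by
            refine hr.trans ?_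
            rw [Real.sqrt_le_left (by positivity), mul_pow, sq_abs]
            linarith
          rcases le_total |x₂ - m| |x₁ - m| with hh | hh
          · refine le_trans ?_ (le_trans (le_trans le_add_self le_self_add) le_self_add)
            simp only [hNdef, n1, hh, and_self, if_true]
            refine mul_le_mul' (ENNReal.ofReal_le_ofReal hr2) (le_of_eq ?_)
            congr 1
            rw [hy]; ring
          · refine le_trans ?_ (le_trans le_add_self le_self_add)
            simp only [hNdef, Prod.swap_prod_mk, n2, hh, and_self, if_true]
            refine mul_le_mul' (ENNReal.ofReal_le_ofReal hr2) (le_of_eq ?_)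
            congr 1
            rw [hy]; ring
    _ = ∫⁻ p, (A p + A p.swap + N p + N p.swap + S p) := by
        rw [Measure.volume_eq_prod, lintegral_prod]
        exact ((((mA.add mA').add mN).add mN').add mS).aemeasurable
    _ = (∫⁻ p, A p) + (∫⁻ p : ℝ × ℝ, A p.swap) + (∫⁻ p, N p) + (∫⁻ p : ℝ × ℝ, N p.swap) + ∫⁻ p, S p := by
        rw [lintegral_add_right _ mS, lintegral_add_right _ mN', lintegral_add_right _ mN,
          lintegral_add_right _ mA']
    _ ≤ _ := by gcongr

/-- The weight `(1 + (τ - ξ³)²)^(-b)` at the frequency `(τ, ξ)`. -/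
def modulation (b : ℝ) (k : ℝ × ℝ) : ENNReal := japanese b (k.1 - k.2 ^ 3)

@[fun_prop]
lemma measurable_modulation (b : ℝ) : Measurable (modulation b) := by
  unfold modulation; fun_prop

lemma japanese_half_sq (b x : ℝ) : japanese (b / 2) x ^ 2 = japanese b x := by
  unfold japanese
  rw [← ENNReal.ofReal_pow (by positivity), ← Real.rpow_mul_natCast (by positivity)]
  congr 2
  push_cast; ring

lemma modulation_half_sq (b : ℝ) (k : ℝ × ℝ) : modulation (b / 2) k ^ 2 = modulation b k :=
  japanese_half_sq b _

lemma sq_lintegral_mul_le {α : Type*} [MeasurableSpace α] {μ : Measure α} {f g : α → ENNReal}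
    (hf : AEMeasurable f μ) (hg : AEMeasurable g μ) :
    (∫⁻ x, f x * g x ∂μ) ^ 2 ≤ (∫⁻ x, f x ^ 2 ∂μ) * ∫⁻ x, g x ^ 2 ∂μ := by
  have h := ENNReal.lintegral_mul_le_Lp_mul_Lq μ (Real.HolderConjugate.two_two) hf hg
  have h2 := pow_le_pow_left' h 2
  simp only [Pi.mul_apply, ENNReal.rpow_two] at h2
  refine h2.trans (le_of_eq ?_)
  rw [mul_pow, ← ENNReal.rpow_two, ← ENNReal.rpow_two, ← ENNReal.rpow_mul, ← ENNReal.rpow_mul]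
  norm_num

lemma exists_lintegral_pair_kernel_le {b : ℝ} (hb : 1 / 2 < b) :
    ∃ C : ENNReal, C < ⊤ ∧ ∀ κ : ℝ × ℝ,
      ∫⁻ a : ℝ × ℝ, (if |a.2| ≤ 2 / 3 * |(κ - a).2| then
        ENNReal.ofReal (1 + (κ - a).2 ^ 2) * (modulation b a * modulation b (κ - a)) else 0) ≤ C := by
  obtain ⟨C₁, hC₁, h₁⟩ := exists_lintegral_japanese_mul_le hb
  obtain ⟨C₂, hC₂, h₂⟩ := exists_lintegral_pair_le hb
  refine ⟨C₁ * C₂, ENNReal.mul_lt_top hC₁ hC₂, fun κ => ?_⟩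
  have hm : Measurable fun a : ℝ × ℝ => (if |a.2| ≤ 2 / 3 * |(κ - a).2| then
      ENNReal.ofReal (1 + (κ - a).2 ^ 2) * (modulation b a * modulation b (κ - a)) else 0) :=
    Measurable.ite (measurableSet_le (by fun_prop) (by fun_prop)) (by fun_prop) (by fun_prop)
  rw [Measure.volume_eq_prod, lintegral_prod_symm _ hm.aemeasurable]
  calc _ ≤ ∫⁻ x, C₁ * (if |x| ≤ 2 / 3 * |κ.2 - x| then
        ENNReal.ofReal (1 + (κ.2 - x) ^ 2) * japanese b (κ.1 - x ^ 3 - (κ.2 - x) ^ 3) else 0) := by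
        refine lintegral_mono fun x => ?_
        by_cases hx : |x| ≤ 2 / 3 * |κ.2 - x|
        · simp only [Prod.snd_sub, hx, if_true, modulation, Prod.fst_sub]
          rw [lintegral_const_mul' _ _ (by simp), mul_left_comm]
          exact mul_le_mul' le_rfl (h₁ _ _ _)
        · simp [hx]
    _ ≤ C₁ * C₂ := by
        rw [lintegral_const_mul' _ _ hC₁.ne]
        exact mul_le_mul' le_rfl (h₂ _ _)

lemma exists_lintegral_triple_kernel_le {b δ : ℝ} (hb : 1 / 2 < b) (hδ : 0 < δ)
    (hδ' : δ < 1 / 2) :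
    ∃ C : ENNReal, C < ⊤ ∧ ∀ κ : ℝ × ℝ, ∫⁻ p : ℝ × ℝ, ∫⁻ q : ℝ × ℝ,
      (if |p.2| ≤ |(-κ - p - q).2| ∧ |q.2| ≤ |(-κ - p - q).2| then
        ENNReal.ofReal ((1 + (-κ - p - q).2 ^ 2) ^ (1 / 2 - δ)) *
          (modulation b p * (modulation b q * modulation b (-κ - p - q))) else 0) ≤ C := by
  obtain ⟨C₁, hC₁, h₁⟩ := exists_lintegral_japanese_mul_le hb
  obtain ⟨C₂, hC₂, h₂⟩ := exists_lintegral_triple_le hb hδ hδ'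
  refine ⟨C₁ * (C₁ * C₂), ENNReal.mul_lt_top hC₁ (ENNReal.mul_lt_top hC₁ hC₂), fun κ => ?_⟩
  set t := -κ.1 with ht
  set y := -κ.2 with hy
  have mle : ∀ f g : ℝ × ℝ → ℝ, Measurable f → Measurable g → MeasurableSet {p | f p ≤ g p} :=
    fun f g hf hg => measurableSet_le hf hg
  -- first integrate out the time frequency of `q`
  set G : ℝ × ℝ → ℝ → ENNReal := fun p x₂ =>
    C₁ * (if |p.2| ≤ |y - p.2 - x₂| ∧ |x₂| ≤ |y - p.2 - x₂| then
      ENNReal.ofReal ((1 + (y - p.2 - x₂) ^ 2) ^ (1 / 2 - δ)) * (modulation b p *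
        japanese b (t - p.1 - x₂ ^ 3 - (y - p.2 - x₂) ^ 3)) else 0) with hG
  have step1 : ∀ p : ℝ × ℝ, ∫⁻ q : ℝ × ℝ,
      (if |p.2| ≤ |(-κ - p - q).2| ∧ |q.2| ≤ |(-κ - p - q).2| then
        ENNReal.ofReal ((1 + (-κ - p - q).2 ^ 2) ^ (1 / 2 - δ)) *
          (modulation b p * (modulation b q * modulation b (-κ - p - q))) else 0) ≤
      ∫⁻ x₂, G p x₂ := by
    intro p
    have hm : Measurable fun q : ℝ × ℝ =>
      (if |p.2| ≤ |(-κ - p - q).2| ∧ |q.2| ≤ |(-κ - p - q).2| then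
        ENNReal.ofReal ((1 + (-κ - p - q).2 ^ 2) ^ (1 / 2 - δ)) *
          (modulation b p * (modulation b q * modulation b (-κ - p - q))) else 0) :=
      Measurable.ite ((mle (fun q => |p.2|) (fun q => |(-κ - p - q).2|) (by fun_prop)
        (by fun_prop)).inter (mle (fun q => |q.2|) (fun q => |(-κ - p - q).2|) (by fun_prop)
        (by fun_prop))) (by fun_prop) (by fun_prop)
    rw [Measure.volume_eq_prod, lintegral_prod_symm _ hm.aemeasurable]
    refine lintegral_mono fun x₂ => ?_
    by_cases hx : |p.2| ≤ |y - p.2 - x₂| ∧ |x₂| ≤ |y - p.2 - x₂|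
    · simp only [Prod.snd_sub, Prod.snd_neg, ← hy, hG, hx, and_self, if_true]
      rw [lintegral_const_mul' _ _ (by simp),
        lintegral_const_mul' _ _ (by simp [modulation, japanese])]
      simp only [modulation, Prod.fst_sub, Prod.snd_sub, Prod.fst_neg, Prod.snd_neg, ← ht, ← hy]
      exact (mul_le_mul' le_rfl (mul_le_mul' le_rfl (h₁ _ _ _))).trans (le_of_eq (by ring))
    · simp only [Prod.snd_sub, Prod.snd_neg, ← hy, hx, if_false, lintegral_zero]
      exact zero_le
  have hGm : Measurable (Function.uncurry G) := by
    have mle : ∀ f g : (ℝ × ℝ) × ℝ → ℝ, Measurable f → Measurable g →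
      MeasurableSet {p | f p ≤ g p} := fun f g hf hg => measurableSet_le hf hg
    refine Measurable.const_mul (Measurable.ite
      ((mle (fun r => |r.1.2|) (fun r => |y - r.1.2 - r.2|) (by fun_prop) (by fun_prop)).inter
        (mle (fun r => |r.2|) (fun r => |y - r.1.2 - r.2|) (by fun_prop) (by fun_prop)))
      (by fun_prop) (by fun_prop)) _
  refine (lintegral_mono step1).trans ?_
  have hGm' : Measurable fun p => ∫⁻ x, G p x := hGm.lintegral_prod_right'
  rw [Measure.volume_eq_prod, lintegral_prod_symm _ hGm'.aemeasurable]
  calc _ ≤ ∫⁻ x₁, C₁ * (C₁ * ∫⁻ x₂, (if |x₁| ≤ |y - x₁ - x₂| ∧ |x₂| ≤ |y - x₁ - x₂| then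
        ENNReal.ofReal ((1 + (y - x₁ - x₂) ^ 2) ^ (1 / 2 - δ)) *
          japanese b (t - x₁ ^ 3 - x₂ ^ 3 - (y - x₁ - x₂) ^ 3) else 0)) := by
        refine lintegral_mono fun x₁ => ?_
        dsimp only
        rw [lintegral_lintegral_swap (by
          refine Measurable.aemeasurable ?_
          exact hGm.comp (g := Function.uncurry G)
            (f := fun r : ℝ × ℝ => ((r.1, x₁), r.2)) (by fun_prop)),
          ← lintegral_const_mul' _ _ hC₁.ne, ← lintegral_const_mul' _ _ hC₁.ne]
        refine lintegral_mono fun x₂ => ?_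
        simp only [hG]
        rw [lintegral_const_mul' _ _ hC₁.ne]
        refine mul_le_mul' le_rfl ?_
        by_cases hx : |x₁| ≤ |y - x₁ - x₂| ∧ |x₂| ≤ |y - x₁ - x₂|
        · simp only [hx, and_self, if_true, modulation]
          rw [lintegral_const_mul' _ _ (by simp), mul_left_comm]
          refine mul_le_mul' le_rfl (le_trans (le_of_eq ?_) ((h₁ (x₁ ^ 3)
            (x₂ ^ 3 + (y - x₁ - x₂) ^ 3) t).trans (le_of_eq ?_)))
          · refine lintegral_congr fun τ => ?_
            congr 2; ring
          · congr 2; ring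
        · simp [hx]
    _ ≤ _ := by
        rw [lintegral_const_mul' _ _ hC₁.ne, lintegral_const_mul' _ _ hC₁.ne]
        exact mul_le_mul' le_rfl (mul_le_mul' le_rfl (h₂ _ _))

/-- Linear parametrization of the quintuples of frequencies with zero sum. -/
def zeroSum : ((ℝ × ℝ) × (ℝ × ℝ) × (ℝ × ℝ) × (ℝ × ℝ)) →ₗ[ℝ] (Fin 5 → ℝ × ℝ) where
  toFun w := ![w.2.1, w.2.2.1, w.2.2.2, -w.1 - w.2.2.1 - w.2.2.2, w.1 - w.2.1]
  map_add' v w := by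
    ext i <;> fin_cases i <;> simp <;> ring
  map_smul' c w := by
    ext i <;> fin_cases i <;> simp <;> ring

lemma sum_zeroSum (w : (ℝ × ℝ) × (ℝ × ℝ) × (ℝ × ℝ) × (ℝ × ℝ)) : ∑ i, zeroSum w i = 0 := by
  simp only [zeroSum, LinearMap.coe_mk, AddHom.coe_mk, Fin.sum_univ_five]
  simp only [Matrix.cons_val]
  abel

lemma zeroSum_injective : Function.Injective zeroSum := by
  intro v w h
  have h0 := congrFun h 0
  have h1 := congrFun h 1
  have h2 := congrFun h 2
  have h4 := congrFun h 4
  simp only [zeroSum, LinearMap.coe_mk, AddHom.coe_mk, Matrix.cons_val] at h0 h1 h2 h4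
  rw [h0, sub_left_inj] at h4
  ext1
  · exact h4
  ext1
  · exact h0
  ext1
  · exact h1
  · exact h2

/-- The action of a permutation of the frequencies on the parameters of `zeroSum`. -/
def zeroSumPerm (σ : Equiv.Perm (Fin 5)) :
    Module.End ℝ ((ℝ × ℝ) × (ℝ × ℝ) × (ℝ × ℝ) × (ℝ × ℝ)) where
  toFun w := (zeroSum w (σ 0) + zeroSum w (σ 4), zeroSum w (σ 0), zeroSum w (σ 1), zeroSum w (σ 2))
  map_add' v w := by
    simp only [map_add, Pi.add_apply, Prod.mk_add_mk, Prod.mk.injEq, and_true]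
    abel
  map_smul' c w := by
    simp only [map_smul, Pi.smul_apply, Prod.smul_mk, smul_add, RingHom.id_apply]

lemma zeroSum_zeroSumPerm (σ : Equiv.Perm (Fin 5))
    (w : (ℝ × ℝ) × (ℝ × ℝ) × (ℝ × ℝ) × (ℝ × ℝ)) :
    zeroSum (zeroSumPerm σ w) = zeroSum w ∘ σ := by
  have hs : ∑ i, zeroSum w (σ i) = 0 := by
    rw [Equiv.sum_comp σ (zeroSum w)]; exact sum_zeroSum w
  rw [Fin.sum_univ_five] at hs
  have h3 : -(zeroSum w (σ 0) + zeroSum w (σ 4)) - zeroSum w (σ 1) - zeroSum w (σ 2) =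
      zeroSum w (σ 3) := by
    rw [sub_sub, sub_eq_iff_eq_add, eq_comm, ← sub_eq_zero, ← hs]; abel
  have h4 : zeroSum w (σ 0) + zeroSum w (σ 4) - zeroSum w (σ 0) = zeroSum w (σ 4) := by abel
  funext i
  rw [Function.comp_apply]
  fin_cases i
  · rfl
  · rfl
  · rfl
  · exact h3
  · exact h4

lemma zeroSumPerm_mul (σ τ : Equiv.Perm (Fin 5)) :
    zeroSumPerm (σ * τ) = zeroSumPerm τ * zeroSumPerm σ := by
  refine LinearMap.ext fun w => zeroSum_injective ?_
  rw [Module.End.mul_apply, zeroSum_zeroSumPerm, zeroSum_zeroSumPerm, zeroSum_zeroSumPerm]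
  rfl

lemma zeroSumPerm_one : zeroSumPerm 1 = 1 := by
  refine LinearMap.ext fun w => zeroSum_injective ?_
  rw [zeroSum_zeroSumPerm]
  rfl

lemma zeroSumPerm_pow (σ : Equiv.Perm (Fin 5)) (n : ℕ) :
    zeroSumPerm (σ ^ n) = zeroSumPerm σ ^ n := by
  induction n with
  | zero => simpa using zeroSumPerm_one
  | succ n ih => rw [pow_succ, zeroSumPerm_mul, ih, ← pow_succ']

lemma abs_det_zeroSumPerm (σ : Equiv.Perm (Fin 5)) : |LinearMap.det (zeroSumPerm σ)| = 1 := by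
  have h : LinearMap.det (zeroSumPerm σ) ^ orderOf σ = 1 := by
    rw [← map_pow, ← zeroSumPerm_pow, pow_orderOf_eq_one, zeroSumPerm_one, map_one]
  have h2 : |LinearMap.det (zeroSumPerm σ)| ^ orderOf σ = 1 := by rw [← abs_pow, h, abs_one]
  exact (pow_eq_one_iff_of_nonneg (abs_nonneg _) (orderOf_pos σ).ne').1 h2

/-- The integral over quintuples of frequencies with zero sum. -/
def zeroSumIntegral (Φ : (Fin 5 → ℝ × ℝ) → ENNReal) : ENNReal :=
  ∫⁻ w, Φ (zeroSum w)

lemma measurable_zeroSum : Measurable zeroSum :=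
  (LinearMap.continuous_of_finiteDimensional zeroSum).measurable

lemma zeroSumIntegral_comp_perm (σ : Equiv.Perm (Fin 5)) {Φ : (Fin 5 → ℝ × ℝ) → ENNReal}
    (hΦ : Measurable Φ) : zeroSumIntegral (fun k => Φ (k ∘ σ)) = zeroSumIntegral Φ := by
  have hd := abs_det_zeroSumPerm σ
  have hmap : Measure.map (zeroSumPerm σ) volume = volume := by
    have i1 : (volume : Measure (ℝ × ℝ)).IsAddHaarMeasure :=
      Measure.prod.instIsAddHaarMeasure volume volume
    have i2 : (volume : Measure ((ℝ × ℝ) × (ℝ × ℝ))).IsAddHaarMeasure :=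
      Measure.prod.instIsAddHaarMeasure volume volume
    have i3 : (volume : Measure ((ℝ × ℝ) × (ℝ × ℝ) × (ℝ × ℝ))).IsAddHaarMeasure :=
      Measure.prod.instIsAddHaarMeasure volume volume
    have i4 : (volume : Measure ((ℝ × ℝ) × (ℝ × ℝ) × (ℝ × ℝ) × (ℝ × ℝ))).IsAddHaarMeasure :=
      Measure.prod.instIsAddHaarMeasure volume volume
    rw [Measure.map_linearMap_addHaar_eq_smul_addHaar volume
      (fun h => by simp [h] at hd), abs_inv, hd]
    simp
  unfold zeroSumIntegral
  conv_rhs => rw [← hmap]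
  have h : Measurable fun w => Φ (zeroSum w) := hΦ.comp measurable_zeroSum
  rw [lintegral_map h
    (LinearMap.continuous_of_finiteDimensional (zeroSumPerm σ)).measurable]
  simp only [zeroSum_zeroSumPerm]

lemma zeroSumIntegral_eq {Φ : (Fin 5 → ℝ × ℝ) → ENNReal} (hΦ : Measurable Φ) :
    zeroSumIntegral Φ = ∫⁻ κ, ∫⁻ a, ∫⁻ p, ∫⁻ q, Φ ![a, p, q, -κ - p - q, κ - a] := by
  have h : Measurable fun w => Φ (zeroSum w) := hΦ.comp measurable_zeroSum
  unfold zeroSumIntegral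
  rw [Measure.volume_eq_prod, lintegral_prod _ h.aemeasurable]
  refine lintegral_congr fun κ => ?_
  have h1 : Measurable fun w => Φ (zeroSum (κ, w)) := h.comp (by fun_prop)
  rw [Measure.volume_eq_prod, lintegral_prod _ h1.aemeasurable]
  refine lintegral_congr fun a => ?_
  have h2 : Measurable fun w => Φ (zeroSum (κ, a, w)) := h.comp (by fun_prop)
  rw [Measure.volume_eq_prod, lintegral_prod _ h2.aemeasurable]
  rfl

lemma lintegral_lintegral_mul_sub {f g : ℝ × ℝ → ENNReal} (hf : Measurable f) (hg : Measurable g) :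
    ∫⁻ κ, ∫⁻ a, f a * g (κ - a) = (∫⁻ a, f a) * ∫⁻ a, g a := by
  rw [lintegral_lintegral_swap (by
    exact Measurable.aemeasurable (by fun_prop : Measurable fun p : (ℝ × ℝ) × (ℝ × ℝ) =>
      f p.2 * g (p.1 - p.2)))]
  rw [← lintegral_mul_const _ hf]
  refine lintegral_congr fun a => ?_
  rw [lintegral_const_mul _ (by fun_prop), lintegral_sub_right_eq_self]

lemma lintegral_neg_sub_eq {h : ℝ × ℝ → ENNReal} (p q : ℝ × ℝ) :
    ∫⁻ κ, h (-κ - p - q) = ∫⁻ κ, h κ := by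
  have e := lintegral_sub_left_eq_self (μ := (volume : Measure (ℝ × ℝ))) h (-p - q)
  rw [← e]
  refine lintegral_congr fun κ => ?_
  congr 1; abel

lemma lintegral_triple_eq {f g h : ℝ × ℝ → ENNReal} (hf : Measurable f) (hg : Measurable g)
    (hh : Measurable h) :
    ∫⁻ κ, ∫⁻ z : (ℝ × ℝ) × (ℝ × ℝ), f z.1 * (g z.2 * h (-κ - z.1 - z.2)) =
      (∫⁻ a, f a) * ((∫⁻ a, g a) * ∫⁻ a, h a) := by
  rw [lintegral_lintegral_swap (by
    exact Measurable.aemeasurable (by fun_prop : Measurable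
      fun p : (ℝ × ℝ) × ((ℝ × ℝ) × (ℝ × ℝ)) => f p.2.1 * (g p.2.2 * h (-p.1 - p.2.1 - p.2.2))))]
  have e : ∀ z : (ℝ × ℝ) × (ℝ × ℝ), ∫⁻ κ, f z.1 * (g z.2 * h (-κ - z.1 - z.2)) =
      f z.1 * (g z.2 * ∫⁻ a, h a) := fun z => by
    rw [lintegral_const_mul _ (by fun_prop), lintegral_const_mul _ (by fun_prop),
      lintegral_neg_sub_eq]
  rw [lintegral_congr e, Measure.volume_eq_prod,
    lintegral_prod_mul hf.aemeasurable (hg.mul_const _).aemeasurable, lintegral_mul_const _ hg]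

lemma lintegral_sq_pair_le {f g : ℝ × ℝ → ENNReal} (hf : Measurable f) (hg : Measurable g)
    {w : (ℝ × ℝ) → (ℝ × ℝ) → ENNReal} (hw : Measurable (Function.uncurry w)) {C : ENNReal}
    (hC : ∀ κ, ∫⁻ a, w a (κ - a) ^ 2 ≤ C) :
    ∫⁻ κ, (∫⁻ a, w a (κ - a) * (f a * g (κ - a))) ^ 2 ≤
      C * ((∫⁻ a, f a ^ 2) * ∫⁻ a, g a ^ 2) := by
  rw [← lintegral_lintegral_mul_sub (hf.pow_const 2) (hg.pow_const 2), ← lintegral_const_mul]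
  · refine lintegral_mono fun κ => ?_
    refine (sq_lintegral_mul_le ?_ ?_).trans ?_
    · exact (hw.comp (f := fun a => (a, κ - a)) (by fun_prop)).aemeasurable
    · fun_prop
    · simp only [mul_pow]
      exact mul_le_mul' (hC κ) le_rfl
  · exact Measurable.lintegral_prod_right' (f := fun p : (ℝ × ℝ) × (ℝ × ℝ) =>
      f p.2 ^ 2 * g (p.1 - p.2) ^ 2) (by fun_prop)

lemma lintegral_sq_triple_le {f g h : ℝ × ℝ → ENNReal} (hf : Measurable f) (hg : Measurable g)
    (hh : Measurable h) {w : (ℝ × ℝ) → (ℝ × ℝ) → (ℝ × ℝ) → ENNReal}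
    (hw : Measurable fun z : (ℝ × ℝ) × (ℝ × ℝ) × (ℝ × ℝ) => w z.1 z.2.1 z.2.2) {C : ENNReal}
    (hC : ∀ κ, ∫⁻ p, ∫⁻ q, w p q (-κ - p - q) ^ 2 ≤ C) :
    ∫⁻ κ, (∫⁻ p, ∫⁻ q, w p q (-κ - p - q) * (f p * (g q * h (-κ - p - q)))) ^ 2 ≤
      C * ((∫⁻ a, f a ^ 2) * ((∫⁻ a, g a ^ 2) * ∫⁻ a, h a ^ 2)) := by
  rw [← lintegral_triple_eq (hf.pow_const 2) (hg.pow_const 2) (hh.pow_const 2),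
    ← lintegral_const_mul]
  · refine lintegral_mono fun κ => ?_
    have hw' : Measurable fun z : (ℝ × ℝ) × (ℝ × ℝ) => w z.1 z.2 (-κ - z.1 - z.2) :=
      hw.comp (f := fun z : (ℝ × ℝ) × (ℝ × ℝ) => (z.1, z.2, -κ - z.1 - z.2)) (by fun_prop)
    have hm : Measurable fun z : (ℝ × ℝ) × (ℝ × ℝ) => w z.1 z.2 (-κ - z.1 - z.2) *
        (f z.1 * (g z.2 * h (-κ - z.1 - z.2))) := by fun_prop
    have e1 := lintegral_prod (μ := (volume : Measure (ℝ × ℝ))) (ν := (volume : Measure (ℝ × ℝ)))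
      _ hm.aemeasurable
    have e2 := lintegral_prod (μ := (volume : Measure (ℝ × ℝ))) (ν := (volume : Measure (ℝ × ℝ)))
      _ (hw'.pow_const 2).aemeasurable
    rw [← e1, Measure.volume_eq_prod]
    refine (sq_lintegral_mul_le hw'.aemeasurable (by fun_prop)).trans ?_
    simp only [mul_pow]
    exact mul_le_mul' (e2.le.trans (hC κ)) le_rfl
  · exact Measurable.lintegral_prod_right' (f := fun p : (ℝ × ℝ) × ((ℝ × ℝ) × (ℝ × ℝ)) =>
      f p.2.1 ^ 2 * (g p.2.2 ^ 2 * h (-p.1 - p.2.1 - p.2.2) ^ 2)) (by fun_prop)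

/-- Bound for the quintilinear form attached to a weight `W`. -/
def QuintilinearBound (W : (Fin 5 → ℝ × ℝ) → ENNReal) (C : ENNReal) : Prop :=
  ∀ f : Fin 5 → ℝ × ℝ → ENNReal, (∀ j, Measurable (f j)) →
    zeroSumIntegral (fun k => W k * ∏ j, f j (k j)) ^ 2 ≤ C * ∏ j, ∫⁻ a, f j a ^ 2

lemma quintilinearBound_pair_triple {w₁ : (ℝ × ℝ) → (ℝ × ℝ) → ENNReal}
    {w₂ : (ℝ × ℝ) → (ℝ × ℝ) → (ℝ × ℝ) → ENNReal} (hw₁ : Measurable (Function.uncurry w₁))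
    (hw₂ : Measurable fun z : (ℝ × ℝ) × (ℝ × ℝ) × (ℝ × ℝ) => w₂ z.1 z.2.1 z.2.2)
    {C₁ C₂ : ENNReal} (hC₁ : ∀ κ, ∫⁻ a, w₁ a (κ - a) ^ 2 ≤ C₁)
    (hC₂ : ∀ κ, ∫⁻ p, ∫⁻ q, w₂ p q (-κ - p - q) ^ 2 ≤ C₂) :
    QuintilinearBound (fun k => w₁ (k 0) (k 4) * w₂ (k 1) (k 2) (k 3)) (C₁ * C₂) := by
  intro f hf
  have m₁ : Measurable fun k : Fin 5 → ℝ × ℝ => w₁ (k 0) (k 4) :=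
    hw₁.comp (f := fun k : Fin 5 → ℝ × ℝ => (k 0, k 4)) (by fun_prop)
  have m₂ : Measurable fun k : Fin 5 → ℝ × ℝ => w₂ (k 1) (k 2) (k 3) :=
    hw₂.comp (f := fun k : Fin 5 → ℝ × ℝ => (k 1, k 2, k 3)) (by fun_prop)
  rw [zeroSumIntegral_eq (by fun_prop)]
  set P : ℝ × ℝ → ENNReal := fun κ => ∫⁻ a, w₁ a (κ - a) * (f 0 a * f 4 (κ - a)) with hP
  set T : ℝ × ℝ → ENNReal := fun κ => ∫⁻ p, ∫⁻ q, w₂ p q (-κ - p - q) *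
    (f 1 p * (f 2 q * f 3 (-κ - p - q))) with hT
  have mP : Measurable P := by
    have := hw₁.comp (f := fun z : (ℝ × ℝ) × (ℝ × ℝ) => (z.2, z.1 - z.2)) (by fun_prop)
    exact Measurable.lintegral_prod_right' (f := fun z : (ℝ × ℝ) × (ℝ × ℝ) =>
      w₁ z.2 (z.1 - z.2) * (f 0 z.2 * f 4 (z.1 - z.2))) (by
        exact this.mul (by fun_prop))
  have mB : Measurable fun z : ((ℝ × ℝ) × (ℝ × ℝ)) × (ℝ × ℝ) =>
      w₂ z.1.2 z.2 (-z.1.1 - z.1.2 - z.2) *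
        (f 1 z.1.2 * (f 2 z.2 * f 3 (-z.1.1 - z.1.2 - z.2))) := by
    have := hw₂.comp (f := fun z : ((ℝ × ℝ) × (ℝ × ℝ)) × (ℝ × ℝ) =>
      (z.1.2, z.2, -z.1.1 - z.1.2 - z.2)) (by fun_prop)
    exact this.mul (by fun_prop)
  have mT : Measurable T := by
    exact Measurable.lintegral_prod_right' (f := fun z : (ℝ × ℝ) × (ℝ × ℝ) =>
      ∫⁻ q, w₂ z.2 q (-z.1 - z.2 - q) * (f 1 z.2 * (f 2 q * f 3 (-z.1 - z.2 - q))))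
      mB.lintegral_prod_right'
  have e : ∀ κ, (∫⁻ a, ∫⁻ p, ∫⁻ q, (fun k : Fin 5 → ℝ × ℝ =>
      w₁ (k 0) (k 4) * w₂ (k 1) (k 2) (k 3) * ∏ j, f j (k j))
        ![a, p, q, -κ - p - q, κ - a]) = P κ * T κ := by
    intro κ
    have n₁ : Measurable fun a => w₁ a (κ - a) * (f 0 a * f 4 (κ - a)) := by
      have := hw₁.comp (f := fun a => (a, κ - a)) (by fun_prop)
      exact this.mul (by fun_prop)
    have n₂ : Measurable fun z : (ℝ × ℝ) × (ℝ × ℝ) => w₂ z.1 z.2 (-κ - z.1 - z.2) *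
        (f 1 z.1 * (f 2 z.2 * f 3 (-κ - z.1 - z.2))) :=
      mB.comp (f := fun z : (ℝ × ℝ) × (ℝ × ℝ) => ((κ, z.1), z.2)) (by fun_prop)
    have n₃ : Measurable fun p => ∫⁻ q, w₂ p q (-κ - p - q) *
        (f 1 p * (f 2 q * f 3 (-κ - p - q))) := n₂.lintegral_prod_right'
    rw [hP, hT, ← lintegral_mul_const _ n₁]
    refine lintegral_congr fun a => ?_
    rw [← lintegral_const_mul _ n₃]
    refine lintegral_congr fun p => ?_
    have n₄ : Measurable fun q => w₂ p q (-κ - p - q) *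
        (f 1 p * (f 2 q * f 3 (-κ - p - q))) := n₂.comp (f := fun q => (p, q)) (by fun_prop)
    rw [← lintegral_const_mul _ n₄]
    refine lintegral_congr fun q => ?_
    simp only [Fin.prod_univ_five, Matrix.cons_val]
    ring
  rw [lintegral_congr e]
  calc _ ≤ (∫⁻ κ, P κ ^ 2) * ∫⁻ κ, T κ ^ 2 :=
        sq_lintegral_mul_le mP.aemeasurable mT.aemeasurable
    _ ≤ _ := mul_le_mul' (lintegral_sq_pair_le (hf 0) (hf 4) hw₁ hC₁)
        (lintegral_sq_triple_le (hf 1) (hf 2) (hf 3) hw₂ hC₂)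
    _ = _ := by rw [Fin.prod_univ_five]; ring

lemma QuintilinearBound.comp_perm {W : (Fin 5 → ℝ × ℝ) → ENNReal} {C : ENNReal}
    (h : QuintilinearBound W C) (hW : Measurable W) (σ : Equiv.Perm (Fin 5)) :
    QuintilinearBound (fun k => W (k ∘ σ)) C := by
  intro f hf
  have h1 := h (fun j => f (σ j)) (fun j => hf _)
  rw [← zeroSumIntegral_comp_perm σ (by fun_prop)] at h1
  simp only [Function.comp_apply] at h1
  rw [Equiv.prod_comp σ (fun j => ∫⁻ a, f j a ^ 2)] at h1
  refine le_trans (le_of_eq ?_) h1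
  congr 2
  funext k
  rw [Equiv.prod_comp σ (fun j => f j (k j))]

lemma QuintilinearBound.add {W₁ W₂ : (Fin 5 → ℝ × ℝ) → ENNReal} {C₁ C₂ : ENNReal}
    (h₁ : QuintilinearBound W₁ C₁) (h₂ : QuintilinearBound W₂ C₂) (hW₁ : Measurable W₁) :
    QuintilinearBound (fun k => W₁ k + W₂ k) (2 * (C₁ + C₂)) := by
  intro f hf
  have e : zeroSumIntegral (fun k => (W₁ k + W₂ k) * ∏ j, f j (k j)) =
      zeroSumIntegral (fun k => W₁ k * ∏ j, f j (k j)) +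
        zeroSumIntegral (fun k => W₂ k * ∏ j, f j (k j)) := by
    unfold zeroSumIntegral
    rw [← lintegral_add_left]
    · simp only [add_mul]
    · have : Measurable fun k : Fin 5 → ℝ × ℝ => W₁ k * ∏ j, f j (k j) := by fun_prop
      exact this.comp measurable_zeroSum
  rw [e]
  have h3 := ENNReal.rpow_add_le_mul_rpow_add_rpow
    (zeroSumIntegral (fun k => W₁ k * ∏ j, f j (k j)))
    (zeroSumIntegral (fun k => W₂ k * ∏ j, f j (k j))) (p := 2) (by norm_num)
  norm_num at h3
  refine h3.trans ?_
  rw [mul_assoc, add_mul]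
  exact mul_le_mul' le_rfl (add_le_add (h₁ f hf) (h₂ f hf))

lemma QuintilinearBound.sum {ι : Type*} (s : Finset ι) {W : ι → (Fin 5 → ℝ × ℝ) → ENNReal}
    {C : ENNReal} (hC : C < ⊤) (h : ∀ i, QuintilinearBound (W i) C) (hW : ∀ i, Measurable (W i)) :
    ∃ C' : ENNReal, C' < ⊤ ∧ QuintilinearBound (fun k => ∑ i ∈ s, W i k) C' := by
  classical
  induction s using Finset.induction_on with
  | empty =>
    refine ⟨0, by simp, fun f hf => ?_⟩
    simp [zeroSumIntegral]
  | insert i s hi ih =>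
    obtain ⟨C', hC', h'⟩ := ih
    refine ⟨2 * (C + C'), ENNReal.mul_lt_top (by simp) (ENNReal.add_lt_top.2 ⟨hC, hC'⟩), ?_⟩
    have := (h i).add h' (hW i)
    simpa only [Finset.sum_insert hi] using this

lemma QuintilinearBound.mono {W W' : (Fin 5 → ℝ × ℝ) → ENNReal} {C c : ENNReal}
    (h : QuintilinearBound W C) (hc : c < ⊤) (hle : ∀ k, ∑ i, k i = 0 → W' k ≤ c * W k) :
    QuintilinearBound W' (c ^ 2 * C) := by
  intro f hf
  refine (pow_le_pow_left' (?_ : _ ≤ c * zeroSumIntegral (fun k => W k * ∏ j, f j (k j))) 2).trans ?_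
  · unfold zeroSumIntegral
    rw [← lintegral_const_mul' _ _ hc.ne]
    refine lintegral_mono fun w => ?_
    rw [← mul_assoc]
    exact mul_le_mul' (hle _ (sum_zeroSum w)) le_rfl
  · rw [mul_pow, mul_assoc]
    exact mul_le_mul' le_rfl (h f hf)

lemma abs_le_two_thirds_of_sum_eq_zero {x : Fin 5 → ℝ} (hx : Monotone fun j => |x j|)
    (h : ∑ j, x j = 0) : |x 0| ≤ 2 / 3 * |x 4| := by
  rw [Fin.sum_univ_five] at h
  have h1 : |x 0| ≤ |x 1| := hx (by decide)
  have h2 : |x 1| ≤ |x 2| := hx (by decide)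
  have h3 : |x 2| ≤ |x 3| := hx (by decide)
  have h4 : |x 3| ≤ |x 4| := hx (by decide)
  by_contra! hc
  rcases abs_cases (x 0) with ⟨e0, -⟩ | ⟨e0, -⟩ <;>
  rcases abs_cases (x 1) with ⟨e1, -⟩ | ⟨e1, -⟩ <;>
  rcases abs_cases (x 2) with ⟨e2, -⟩ | ⟨e2, -⟩ <;>
  rcases abs_cases (x 3) with ⟨e3, -⟩ | ⟨e3, -⟩ <;>
  rcases abs_cases (x 4) with ⟨e4, -⟩ | ⟨e4, -⟩ <;>
  linarith

lemma abs_le_four_mul_of_sum_eq_zero {x : Fin 5 → ℝ} (hx : Monotone fun j => |x j|)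
    (h : ∑ j, x j = 0) : |x 4| ≤ 4 * |x 3| := by
  rw [Fin.sum_univ_five] at h
  have h1 : |x 0| ≤ |x 1| := hx (by decide)
  have h2 : |x 1| ≤ |x 2| := hx (by decide)
  have h3 : |x 2| ≤ |x 3| := hx (by decide)
  refine abs_le'.2 ⟨?_, ?_⟩
  · linarith [neg_abs_le (x 0), neg_abs_le (x 1), neg_abs_le (x 2), neg_abs_le (x 3)]
  · linarith [le_abs_self (x 0), le_abs_self (x 1), le_abs_self (x 2), le_abs_self (x 3)]

lemma weight_le_of_small_modulation {σ M m₃ L ξ : ℝ} (hσ0 : 0 < σ) (hσ : σ < 1 / 2)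
    (hL1 : 1 ≤ L) (hL : L ≤ 10 ^ 4 * M ^ 3) (hξ : 1 + ξ ^ 2 ≤ M) (hM : M ≤ 16 * m₃) :
    |ξ| * (1 + ξ ^ 2) ^ (σ / 2) * L ^ ((-1 / 2 + 2 * ((1 / 2 - σ) / 18)) / 2) ≤
      (10 ^ 4 * 16) * (M ^ ((1 : ℝ) / 2) * m₃ ^ ((1 / 2 - (1 / 2 - σ) / 2) / 2) *
        L ^ (-((1 / 2 + (1 / 2 - σ) / 18) / 2))) := by
  have hM1 : 1 ≤ M := by nlinarith [sq_nonneg ξ]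
  have hM0 : 0 < M := by linarith
  have hL0 : 0 < L := by linarith
  have hm0 : 0 < m₃ := by linarith
  set s := 1 / 2 - σ with hs
  have hs0 : 0 < s := by linarith
  have k1 : |ξ| ≤ M ^ ((1 : ℝ) / 2) := by
    rw [← Real.sqrt_eq_rpow]
    exact Real.abs_le_sqrt (by linarith)
  have k2 : (1 + ξ ^ 2) ^ (σ / 2) ≤ M ^ (σ / 2) :=
    Real.rpow_le_rpow (by positivity) hξ (by linarith)
  have k3 : L ^ ((-1 / 2 + 2 * (s / 18)) / 2) =
      L ^ (s / 12) * L ^ (-((1 / 2 + s / 18) / 2)) := by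
    rw [← Real.rpow_add hL0]; congr 1; ring
  have k4 : L ^ (s / 12) ≤ 10 ^ 4 * M ^ (s / 4) := by
    calc L ^ (s / 12) ≤ (10 ^ 4 * M ^ 3) ^ (s / 12) :=
          Real.rpow_le_rpow hL0.le hL (by linarith)
      _ = (10 ^ 4) ^ (s / 12) * M ^ (s / 4) := by
          rw [Real.mul_rpow (by positivity) (by positivity), ← Real.rpow_natCast_mul hM0.le]
          congr 2; push_cast; ring
      _ ≤ _ := by
          gcongr
          exact (Real.rpow_le_rpow_of_exponent_le (by norm_num) (by linarith : s / 12 ≤ 1)).trans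
            (by rw [Real.rpow_one])
  have k5 : M ^ (σ / 2) * M ^ (s / 4) ≤ 16 * m₃ ^ ((1 / 2 - s / 2) / 2) := by
    rw [← Real.rpow_add hM0]
    have e : σ / 2 + s / 4 = (1 / 2 - s / 2) / 2 := by rw [hs]; ring
    rw [e]
    have p : 0 ≤ (1 / 2 - s / 2) / 2 := by linarith
    refine (Real.rpow_le_rpow hM0.le hM p).trans ?_
    rw [Real.mul_rpow (by norm_num) hm0.le]
    gcongr
    exact (Real.rpow_le_rpow_of_exponent_le (by norm_num)
      (by linarith : (1 / 2 - s / 2) / 2 ≤ 1)).trans (by rw [Real.rpow_one])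
  rw [k3]
  set E := L ^ (-((1 / 2 + s / 18) / 2)) with hE
  have hE0 : 0 ≤ E := by positivity
  calc |ξ| * (1 + ξ ^ 2) ^ (σ / 2) * (L ^ (s / 12) * E)
      ≤ M ^ ((1 : ℝ) / 2) * M ^ (σ / 2) * ((10 ^ 4 * M ^ (s / 4)) * E) := by gcongr
    _ = 10 ^ 4 * M ^ ((1 : ℝ) / 2) * E * (M ^ (σ / 2) * M ^ (s / 4)) := by ring
    _ ≤ 10 ^ 4 * M ^ ((1 : ℝ) / 2) * E * (16 * m₃ ^ ((1 / 2 - s / 2) / 2)) := by gcongr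
    _ = _ := by ring

lemma weight_le_one_of_large_modulation {σ M L ξ : ℝ} (hσ0 : 0 < σ) (hσ : σ < 1 / 2)
    (hL : M ^ 3 ≤ L) (hξ : 1 + ξ ^ 2 ≤ M) :
    |ξ| * (1 + ξ ^ 2) ^ (σ / 2) * L ^ ((-1 / 2 + 2 * ((1 / 2 - σ) / 18)) / 2) ≤ 1 := by
  have hM1 : 1 ≤ M := by nlinarith [sq_nonneg ξ]
  have hM0 : 0 < M := by linarith
  have hL0 : 0 ≤ L := (by positivity : 0 ≤ M ^ 3).trans hL
  have k1 : |ξ| ≤ M ^ ((1 : ℝ) / 2) := by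
    rw [← Real.sqrt_eq_rpow]
    exact Real.abs_le_sqrt (by linarith)
  have k2 : (1 + ξ ^ 2) ^ (σ / 2) ≤ M ^ (σ / 2) :=
    Real.rpow_le_rpow (by positivity) hξ (by linarith)
  have k3 : L ^ ((-1 / 2 + 2 * ((1 / 2 - σ) / 18)) / 2) ≤
      M ^ (3 * ((-1 / 2 + 2 * ((1 / 2 - σ) / 18)) / 2)) := by
    refine (Real.rpow_le_rpow_of_nonpos (by positivity) hL (by linarith)).trans (le_of_eq ?_)
    rw [← Real.rpow_natCast_mul hM0.le]
    norm_num
  calc _ ≤ M ^ ((1 : ℝ) / 2) * M ^ (σ / 2) * M ^ (3 * ((-1 / 2 + 2 * ((1 / 2 - σ) / 18)) / 2)) := by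
        gcongr
    _ = M ^ (1 / 2 + σ / 2 + 3 * ((-1 / 2 + 2 * ((1 / 2 - σ) / 18)) / 2)) := by
        rw [← Real.rpow_add hM0, ← Real.rpow_add hM0]
    _ ≤ 1 := Real.rpow_le_one_of_one_le_of_nonpos hM1 (by linarith)

lemma japanese_le_mul_of_large {b M x y₁ y₂ y₃ : ℝ} (hb : 0 ≤ b) (hM : M ^ 3 ≤ 1 + x ^ 2)
    (h₁ : 1 + y₁ ^ 2 ≤ M) (h₂ : 1 + y₂ ^ 2 ≤ M) (h₃ : 1 + y₃ ^ 2 ≤ M) :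
    japanese b x ≤ japanese b y₁ * (japanese b y₂ * japanese b y₃) := by
  have hM1 : 1 ≤ M := by nlinarith [sq_nonneg y₁]
  unfold japanese
  rw [← ENNReal.ofReal_mul (by positivity), ← ENNReal.ofReal_mul (by positivity)]
  apply ENNReal.ofReal_le_ofReal
  rw [← Real.mul_rpow (by positivity) (by positivity),
    ← Real.mul_rpow (by positivity) (by positivity)]
  refine Real.rpow_le_rpow_of_nonpos (by positivity) (le_trans ?_ hM) (by linarith)
  calc _ ≤ M * (M * M) := by gcongr
    _ = _ := by ring

lemma exists_large_modulation {τ ξ : Fin 5 → ℝ} {M : ℝ} (hτ : ∑ j, τ j = 0)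
    (hM : ∀ j, 1 + ξ j ^ 2 ≤ M) (h : 10 ^ 4 * M ^ 3 < 1 + (τ 0 - ξ 0 ^ 3) ^ 2) :
    ∃ j, j ≠ 0 ∧ M ^ 3 ≤ 1 + (τ j - ξ j ^ 3) ^ 2 := by
  have hM1 : 1 ≤ M := by nlinarith [hM 0, sq_nonneg (ξ 0)]
  set R := Real.sqrt (M ^ 3) with hR
  have hR2 : R ^ 2 = M ^ 3 := Real.sq_sqrt (by positivity)
  have hR1 : 1 ≤ R := by
    rw [hR, Real.one_le_sqrt]; exact one_le_pow₀ hM1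
  have hξ : ∀ j, |ξ j ^ 3| ≤ R := fun j => by
    refine Real.abs_le_sqrt ?_
    have := pow_le_pow_left₀ (sq_nonneg (ξ j)) (by linarith [hM j] : ξ j ^ 2 ≤ M) 3
    calc (ξ j ^ 3) ^ 2 = (ξ j ^ 2) ^ 3 := by ring
      _ ≤ _ := this
  by_contra! hc
  have hsmall : ∀ j, j ≠ 0 → |τ j - ξ j ^ 3| ≤ R := fun j hj => by
    refine Real.abs_le_sqrt ?_
    linarith [hc j hj]
  have h0 : |τ 0 - ξ 0 ^ 3| ≤ 9 * R := by
    rw [Fin.sum_univ_five] at hτ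
    have a1 := abs_le.1 (hsmall 1 (by decide))
    have a2 := abs_le.1 (hsmall 2 (by decide))
    have a3 := abs_le.1 (hsmall 3 (by decide))
    have a4 := abs_le.1 (hsmall 4 (by decide))
    have b0 := abs_le.1 (hξ 0)
    have b1 := abs_le.1 (hξ 1)
    have b2 := abs_le.1 (hξ 2)
    have b3 := abs_le.1 (hξ 3)
    have b4 := abs_le.1 (hξ 4)
    exact abs_le.2 ⟨by linarith [a1.2, a2.2, a3.2, a4.2, b1.2], by linarith [a1.1]⟩
  have h1 : (τ 0 - ξ 0 ^ 3) ^ 2 ≤ 81 * R ^ 2 := by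
    rw [← sq_abs]; nlinarith [abs_nonneg (τ 0 - ξ 0 ^ 3)]
  nlinarith

/-- Weight of the quintilinear form after sorting the frequencies by size. -/
def sortedWeight (b δ : ℝ) (k : Fin 5 → ℝ × ℝ) : ENNReal :=
  (if |(k 0).2| ≤ 2 / 3 * |(k 4).2| then ENNReal.ofReal ((1 + (k 4).2 ^ 2) ^ ((1 : ℝ) / 2)) *
    (modulation (b / 2) (k 0) * modulation (b / 2) (k 4)) else 0) *
  (if |(k 1).2| ≤ |(k 3).2| ∧ |(k 2).2| ≤ |(k 3).2| then
    ENNReal.ofReal ((1 + (k 3).2 ^ 2) ^ ((1 / 2 - δ) / 2)) *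
    (modulation (b / 2) (k 1) * (modulation (b / 2) (k 2) * modulation (b / 2) (k 3))) else 0)

/-- Square-integrable weight on frequency space. -/
def spreadFactor (b : ℝ) (k : ℝ × ℝ) : ENNReal := japanese (b / 2) k.2 * modulation (b / 2) k

/-- Weight of the quintilinear form with three square-integrable factors. -/
def spreadWeight (b : ℝ) (k : Fin 5 → ℝ × ℝ) : ENNReal :=
  spreadFactor b (k 0) * (spreadFactor b (k 1) * spreadFactor b (k 2))

@[fun_prop]
lemma measurable_spreadFactor (b : ℝ) : Measurable (spreadFactor b) := by
  unfold spreadFactor; fun_prop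

lemma measurable_spreadWeight (b : ℝ) : Measurable (spreadWeight b) := by
  unfold spreadWeight; fun_prop

lemma exists_lintegral_spreadFactor_sq_lt_top {b : ℝ} (hb : 1 / 2 < b) :
    ∫⁻ k, spreadFactor b k ^ 2 < ⊤ := by
  have e : ∀ k, spreadFactor b k ^ 2 = japanese b k.2 * japanese b (k.1 - k.2 ^ 3) := fun k => by
    rw [spreadFactor, mul_pow, japanese_half_sq, modulation_half_sq]; rfl
  rw [lintegral_congr e, Measure.volume_eq_prod, lintegral_prod_symm _ (by fun_prop)]
  have e2 : ∀ x : ℝ, ∫⁻ τ, japanese b x * japanese b (τ - x ^ 3) =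
      japanese b x * ∫⁻ τ, japanese b τ := fun x => by
    rw [lintegral_const_mul _ (by fun_prop), lintegral_sub_right_eq_self (fun τ => japanese b τ)]
  simp only [e2]
  rw [lintegral_mul_const _ (by fun_prop)]
  exact ENNReal.mul_lt_top (lintegral_japanese_lt_top hb) (lintegral_japanese_lt_top hb)

lemma exists_quintilinearBound_spreadWeight {b : ℝ} (hb : 1 / 2 < b) :
    ∃ C : ENNReal, C < ⊤ ∧ QuintilinearBound (spreadWeight b) C := by
  have h := exists_lintegral_spreadFactor_sq_lt_top hb
  refine ⟨_, ENNReal.mul_lt_top h (ENNReal.mul_lt_top h h),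
    quintilinearBound_pair_triple (w₁ := fun a _ => spreadFactor b a)
      (w₂ := fun p q _ => spreadFactor b p * spreadFactor b q) (by fun_prop) (by fun_prop)
      (fun κ => le_rfl) (fun κ => le_of_eq ?_)⟩
  simp only [mul_pow]
  rw [lintegral_congr fun p => lintegral_const_mul (spreadFactor b p ^ 2)
    (by fun_prop : Measurable fun q => spreadFactor b q ^ 2), lintegral_mul_const _ (by fun_prop)]

lemma measurable_pairWeight (b : ℝ) : Measurable fun z : (ℝ × ℝ) × (ℝ × ℝ) =>
    (if |z.1.2| ≤ 2 / 3 * |z.2.2| then ENNReal.ofReal ((1 + z.2.2 ^ 2) ^ ((1 : ℝ) / 2)) *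
      (modulation (b / 2) z.1 * modulation (b / 2) z.2) else 0) :=
  Measurable.ite (measurableSet_le (by fun_prop) (by fun_prop)) (by fun_prop) (by fun_prop)

lemma measurable_tripleWeight (b δ : ℝ) : Measurable fun z : (ℝ × ℝ) × (ℝ × ℝ) × (ℝ × ℝ) =>
    (if |z.1.2| ≤ |z.2.2.2| ∧ |z.2.1.2| ≤ |z.2.2.2| then
      ENNReal.ofReal ((1 + z.2.2.2 ^ 2) ^ ((1 / 2 - δ) / 2)) *
      (modulation (b / 2) z.1 * (modulation (b / 2) z.2.1 * modulation (b / 2) z.2.2)) else 0) := by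
  have mle : ∀ f g : (ℝ × ℝ) × (ℝ × ℝ) × (ℝ × ℝ) → ℝ, Measurable f → Measurable g →
    MeasurableSet {p | f p ≤ g p} := fun f g hf hg => measurableSet_le hf hg
  exact Measurable.ite ((mle (fun z => |z.1.2|) (fun z => |z.2.2.2|) (by fun_prop)
    (by fun_prop)).inter (mle (fun z => |z.2.1.2|) (fun z => |z.2.2.2|) (by fun_prop)
    (by fun_prop))) (by fun_prop) (by fun_prop)

lemma measurable_sortedWeight (b δ : ℝ) : Measurable (sortedWeight b δ) := by
  have h₁ := (measurable_pairWeight b).comp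
    (f := fun k : Fin 5 → ℝ × ℝ => (k 0, k 4)) (by fun_prop)
  have h₂ := (measurable_tripleWeight b δ).comp
    (f := fun k : Fin 5 → ℝ × ℝ => (k 1, k 2, k 3)) (by fun_prop)
  exact h₁.mul h₂

lemma ofReal_rpow_half_sq {x : ℝ} (hx : 0 ≤ x) (a : ℝ) :
    ENNReal.ofReal (x ^ (a / 2)) ^ 2 = ENNReal.ofReal (x ^ a) := by
  rw [← ENNReal.ofReal_pow (by positivity), ← Real.rpow_mul_natCast hx]
  congr 2
  push_cast; ring

lemma exists_quintilinearBound_sortedWeight {b δ : ℝ} (hb : 1 / 2 < b) (hδ : 0 < δ)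
    (hδ' : δ < 1 / 2) :
    ∃ C : ENNReal, C < ⊤ ∧ QuintilinearBound (sortedWeight b δ) C := by
  obtain ⟨C₁, hC₁, h₁⟩ := exists_lintegral_pair_kernel_le hb
  obtain ⟨C₂, hC₂, h₂⟩ := exists_lintegral_triple_kernel_le hb hδ hδ'
  refine ⟨_, ENNReal.mul_lt_top hC₁ hC₂, quintilinearBound_pair_triple
    (w₁ := fun p q => if |p.2| ≤ 2 / 3 * |q.2| then
      ENNReal.ofReal ((1 + q.2 ^ 2) ^ ((1 : ℝ) / 2)) *
      (modulation (b / 2) p * modulation (b / 2) q) else 0)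
    (w₂ := fun p q r => if |p.2| ≤ |r.2| ∧ |q.2| ≤ |r.2| then
      ENNReal.ofReal ((1 + r.2 ^ 2) ^ ((1 / 2 - δ) / 2)) *
      (modulation (b / 2) p * (modulation (b / 2) q * modulation (b / 2) r)) else 0)
    (measurable_pairWeight b) (measurable_tripleWeight b δ)
    (fun κ => le_trans (le_of_eq ?_) (h₁ κ)) (fun κ => le_trans (le_of_eq ?_) (h₂ κ))⟩
  · refine lintegral_congr fun a => ?_
    split_ifs
    · rw [mul_pow, mul_pow, modulation_half_sq, modulation_half_sq,
        ofReal_rpow_half_sq (by positivity), Real.rpow_one]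
    · simp
  · refine lintegral_congr fun p => lintegral_congr fun q => ?_
    split_ifs
    · rw [mul_pow, mul_pow, mul_pow, modulation_half_sq, modulation_half_sq, modulation_half_sq,
        ofReal_rpow_half_sq (by positivity)]
    · simp

/-- The weight of the dualized smoothing estimate. -/
def smoothingWeight (σ : ℝ) (k : Fin 5 → ℝ × ℝ) : ENNReal :=
  ENNReal.ofReal (|(k 0).2| * (1 + (k 0).2 ^ 2) ^ (σ / 2) *
    (1 + ((k 0).1 - (k 0).2 ^ 3) ^ 2) ^ ((-1 / 2 + 2 * ((1 / 2 - σ) / 18)) / 2)) *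
  ∏ j : Fin 4, modulation ((1 / 2 + (1 / 2 - σ) / 18) / 2) (k j.succ)

lemma smoothingWeight_le_of_small {σ : ℝ} (hσ0 : 0 < σ) (hσ : σ < 1 / 2) {k : Fin 5 → ℝ × ℝ}
    {π : Equiv.Perm (Fin 5)} (hk : ∑ j, (k j).2 = 0) (hπ : Monotone fun j => |(k (π j)).2|)
    (h : 1 + ((k 0).1 - (k 0).2 ^ 3) ^ 2 ≤ 10 ^ 4 * (1 + (k (π 4)).2 ^ 2) ^ 3) :
    smoothingWeight σ k ≤ ENNReal.ofReal (10 ^ 4 * 16) *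
      sortedWeight (1 / 2 + (1 / 2 - σ) / 18) ((1 / 2 - σ) / 2) (k ∘ π) := by
  have hk' : ∑ j, (k (π j)).2 = 0 := by rw [Equiv.sum_comp π fun j => (k j).2]; exact hk
  have c1 := abs_le_two_thirds_of_sum_eq_zero hπ hk'
  have c2 := abs_le_four_mul_of_sum_eq_zero hπ hk'
  have c3 : |(k (π 1)).2| ≤ |(k (π 3)).2| := hπ (by decide)
  have c4 : |(k (π 2)).2| ≤ |(k (π 3)).2| := hπ (by decide)
  have c0 : |(k 0).2| ≤ |(k (π 4)).2| := by
    have : |(k (π (π.symm 0))).2| ≤ |(k (π 4)).2| := hπ (Fin.le_last _)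
    rwa [Equiv.apply_symm_apply] at this
  have main := weight_le_of_small_modulation (ξ := (k 0).2) (M := 1 + (k (π 4)).2 ^ 2)
    (L := 1 + ((k 0).1 - (k 0).2 ^ 3) ^ 2) (m₃ := 1 + (k (π 3)).2 ^ 2) hσ0 hσ (by nlinarith [sq_nonneg ((k 0).1 - (k 0).2 ^ 3)]) h
    (by linarith [sq_le_sq.2 c0]) (by
      have := pow_le_pow_left₀ (abs_nonneg _) c2 2
      rw [mul_pow, sq_abs, sq_abs] at this
      linarith)
  set b := 1 / 2 + (1 / 2 - σ) / 18 with hb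
  have hprod : (modulation (b / 2) (k 0)) * ∏ j : Fin 4, modulation (b / 2) (k j.succ) =
      ∏ j, modulation (b / 2) (k (π j)) := by
    rw [Equiv.prod_comp π fun j => modulation (b / 2) (k j)]
    exact (Fin.prod_univ_succ fun j => modulation (b / 2) (k j)).symm
  simp only [sortedWeight, Function.comp_apply, c1, c3, c4, and_self, if_true]
  unfold smoothingWeight
  refine (mul_le_mul' (ENNReal.ofReal_le_ofReal main) le_rfl).trans (le_of_eq ?_)
  rw [Fin.prod_univ_five] at hprod
  rw [ENNReal.ofReal_mul (by positivity), mul_assoc]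
  congr 1
  rw [ENNReal.ofReal_mul (by positivity), ENNReal.ofReal_mul (by positivity)]
  change _ * modulation (b / 2) (k 0) * _ = _
  rw [mul_assoc, hprod]
  ring

lemma smoothingWeight_le_of_large {σ : ℝ} (hσ0 : 0 < σ) (hσ : σ < 1 / 2) {k : Fin 5 → ℝ × ℝ}
    {M : ℝ} (hk : ∑ j, (k j).1 = 0) (hM : ∀ j, 1 + (k j).2 ^ 2 ≤ M)
    (h : 10 ^ 4 * M ^ 3 < 1 + ((k 0).1 - (k 0).2 ^ 3) ^ 2) :
    ∃ π : Equiv.Perm (Fin 5), smoothingWeight σ k ≤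
      spreadWeight (1 / 2 + (1 / 2 - σ) / 18) (k ∘ π) := by
  obtain ⟨j, hj, hjM⟩ := exists_large_modulation hk hM h
  have hM0 : 0 ≤ M := by nlinarith [hM 0, sq_nonneg (k 0).2]
  have main := weight_le_one_of_large_modulation (ξ := (k 0).2)
    (L := 1 + ((k 0).1 - (k 0).2 ^ 3) ^ 2) hσ0 hσ
    (by have : 0 ≤ M ^ 3 := by positivity
        linarith) (hM 0)
  set b := 1 / 2 + (1 / 2 - σ) / 18 with hb
  have hb0 : 0 ≤ b / 2 := by rw [hb]; linarith
  have key : ∀ p q r, modulation (b / 2) (k j) ≤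
      japanese (b / 2) (k p).2 * (japanese (b / 2) (k q).2 * japanese (b / 2) (k r).2) :=
    fun p q r => japanese_le_mul_of_large hb0 hjM (hM p) (hM q) (hM r)
  have first : smoothingWeight σ k ≤ ∏ j : Fin 4, modulation (b / 2) (k j.succ) := by
    unfold smoothingWeight
    exact (mul_le_mul' (ENNReal.ofReal_le_one.2 main) le_rfl).trans (one_mul _).le
  refine ⟨Equiv.swap 4 j * Equiv.swap 0 3, first.trans ?_⟩
  have last : ∀ p q r, modulation (b / 2) (k j) * (modulation (b / 2) (k p) *
      (modulation (b / 2) (k q) * modulation (b / 2) (k r))) ≤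
      spreadFactor b (k p) * (spreadFactor b (k q) * spreadFactor b (k r)) := fun p q r => by
    refine (mul_le_mul' (key p q r) le_rfl).trans (le_of_eq ?_)
    unfold spreadFactor; ring
  rw [Fin.prod_univ_four]
  unfold spreadWeight
  simp only [Function.comp_apply, Equiv.Perm.mul_apply]
  fin_cases j
  · exact absurd rfl hj
  · refine le_trans (le_of_eq ?_) (last 3 4 2)
    change modulation (b / 2) (k 1) * modulation (b / 2) (k 2) * modulation (b / 2) (k 3) *
      modulation (b / 2) (k 4) = modulation (b / 2) (k 1) * _
    ring
  · refine le_trans (le_of_eq ?_) (last 3 1 4)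
    change modulation (b / 2) (k 1) * modulation (b / 2) (k 2) * modulation (b / 2) (k 3) *
      modulation (b / 2) (k 4) = modulation (b / 2) (k 2) * _
    ring
  · refine le_trans (le_of_eq ?_) (last 4 1 2)
    change modulation (b / 2) (k 1) * modulation (b / 2) (k 2) * modulation (b / 2) (k 3) *
      modulation (b / 2) (k 4) = modulation (b / 2) (k 3) * _
    ring
  · refine le_trans (le_of_eq ?_) (last 3 1 2)
    change modulation (b / 2) (k 1) * modulation (b / 2) (k 2) * modulation (b / 2) (k 3) *
      modulation (b / 2) (k 4) = modulation (b / 2) (k 4) * _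
    ring

lemma smoothingWeight_le {σ : ℝ} (hσ0 : 0 < σ) (hσ : σ < 1 / 2) {k : Fin 5 → ℝ × ℝ}
    (hk : ∑ j, k j = 0) :
    smoothingWeight σ k ≤ ENNReal.ofReal (10 ^ 4 * 16) * ∑ π : Equiv.Perm (Fin 5),
      (sortedWeight (1 / 2 + (1 / 2 - σ) / 18) ((1 / 2 - σ) / 2) (k ∘ π) +
        spreadWeight (1 / 2 + (1 / 2 - σ) / 18) (k ∘ π)) := by
  have hk₁ : ∑ j, (k j).1 = 0 := by rw [← Prod.fst_sum, hk]; rfl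
  have hk₂ : ∑ j, (k j).2 = 0 := by rw [← Prod.snd_sum, hk]; rfl
  have term : ∀ π : Equiv.Perm (Fin 5),
      sortedWeight (1 / 2 + (1 / 2 - σ) / 18) ((1 / 2 - σ) / 2) (k ∘ π) +
        spreadWeight (1 / 2 + (1 / 2 - σ) / 18) (k ∘ π) ≤ ∑ π : Equiv.Perm (Fin 5),
      (sortedWeight (1 / 2 + (1 / 2 - σ) / 18) ((1 / 2 - σ) / 2) (k ∘ π) +
        spreadWeight (1 / 2 + (1 / 2 - σ) / 18) (k ∘ π)) := fun π =>
    Finset.single_le_sum (f := fun π : Equiv.Perm (Fin 5) =>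
      sortedWeight (1 / 2 + (1 / 2 - σ) / 18) ((1 / 2 - σ) / 2) (k ∘ π) +
        spreadWeight (1 / 2 + (1 / 2 - σ) / 18) (k ∘ π)) (fun _ _ => zero_le)
      (Finset.mem_univ π)
  set π := Tuple.sort fun j => |(k j).2| with hπ_def
  have hπ : Monotone fun j => |(k (π j)).2| := Tuple.monotone_sort fun j => |(k j).2|
  by_cases h : 1 + ((k 0).1 - (k 0).2 ^ 3) ^ 2 ≤ 10 ^ 4 * (1 + (k (π 4)).2 ^ 2) ^ 3
  · exact (smoothingWeight_le_of_small hσ0 hσ hk₂ hπ h).trans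
      (mul_le_mul' le_rfl ((le_add_of_nonneg_right zero_le).trans (term π)))
  · have hM : ∀ j, 1 + (k j).2 ^ 2 ≤ 1 + (k (π 4)).2 ^ 2 := fun j => by
      have : |(k (π (π.symm j))).2| ≤ |(k (π 4)).2| := hπ (Fin.le_last _)
      rw [Equiv.apply_symm_apply] at this
      linarith [sq_le_sq.2 this]
    obtain ⟨ρ, hρ⟩ := smoothingWeight_le_of_large hσ0 hσ hk₁ hM (not_le.1 h)
    refine hρ.trans (((le_add_of_nonneg_left zero_le).trans (term ρ)).trans ?_)
    refine le_mul_of_one_le_left zero_le ?_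
    rw [ENNReal.one_le_ofReal]
    norm_num

lemma exists_quintilinearBound_smoothingWeight {σ : ℝ} (hσ0 : 0 < σ) (hσ : σ < 1 / 2) :
    ∃ C : ENNReal, C < ⊤ ∧ QuintilinearBound (smoothingWeight σ) C := by
  obtain ⟨C₁, hC₁, h₁⟩ := exists_quintilinearBound_sortedWeight
    (b := 1 / 2 + (1 / 2 - σ) / 18) (δ := (1 / 2 - σ) / 2) (by linarith) (by linarith)
    (by linarith)
  obtain ⟨C₂, hC₂, h₂⟩ := exists_quintilinearBound_spreadWeight
    (b := 1 / 2 + (1 / 2 - σ) / 18) (by linarith)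
  have hm₁ := measurable_sortedWeight (1 / 2 + (1 / 2 - σ) / 18) ((1 / 2 - σ) / 2)
  have hm₂ := measurable_spreadWeight (1 / 2 + (1 / 2 - σ) / 18)
  have hm₁' : ∀ π : Equiv.Perm (Fin 5), Measurable fun k : Fin 5 → ℝ × ℝ =>
      sortedWeight (1 / 2 + (1 / 2 - σ) / 18) ((1 / 2 - σ) / 2) (k ∘ π) := fun π =>
    hm₁.comp (measurable_pi_lambda _ fun j => measurable_pi_apply (π j))
  have hm₂' : ∀ π : Equiv.Perm (Fin 5), Measurable fun k : Fin 5 → ℝ × ℝ =>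
      spreadWeight (1 / 2 + (1 / 2 - σ) / 18) (k ∘ π) := fun π =>
    hm₂.comp (measurable_pi_lambda _ fun j => measurable_pi_apply (π j))
  obtain ⟨C, hC, h⟩ := QuintilinearBound.sum Finset.univ
    (ENNReal.mul_lt_top (by simp : (2 : ENNReal) < ⊤) (ENNReal.add_lt_top.2 ⟨hC₁, hC₂⟩))
    (fun π : Equiv.Perm (Fin 5) => (h₁.comp_perm hm₁ π).add (h₂.comp_perm hm₂ π) (hm₁' π))
    (fun π => (hm₁' π).add (hm₂' π))
  exact ⟨_, ENNReal.mul_lt_top (ENNReal.pow_lt_top ENNReal.ofReal_lt_top) hC,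
    h.mono ENNReal.ofReal_lt_top fun k hk => smoothingWeight_le hσ0 hσ hk⟩

open FourierTransform

lemma integral_comp_toLp (f : WithLp 2 (ℝ × ℝ) → ℂ) :
    ∫ p : ℝ × ℝ, f (WithLp.toLp 2 p) = ∫ x, f x :=
  (WithLp.volume_preserving_toLp (U := ℝ) (V := ℝ)).integral_comp
    (MeasurableEquiv.toLp 2 (ℝ × ℝ)).measurableEmbedding f

/-- The spacetime Fourier transform of a Schwartz function is a Schwartz function satisfying the
Fourier inversion formula. -/
lemma exists_schwartzMap_eq_FT2 (u : SchwartzMap (ℝ × ℝ) ℂ) :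
    ∃ v : SchwartzMap (ℝ × ℝ) ℂ, (∀ k, FT2 u k.1 k.2 = v k) ∧ ∀ p : ℝ × ℝ,
      u p = ((((2 * Real.pi) ^ 2)⁻¹ : ℝ) : ℂ) *
        ∫ k, Complex.exp (Complex.I * ((p.1 * k.1 + p.2 * k.2 : ℝ) : ℂ)) * v k := by
  set e : WithLp 2 (ℝ × ℝ) ≃L[ℝ] (ℝ × ℝ) := WithLp.prodContinuousLinearEquiv 2 ℝ ℝ ℝ with he
  set U : SchwartzMap (WithLp 2 (ℝ × ℝ)) ℂ :=
    SchwartzMap.compCLMOfContinuousLinearEquiv ℂ e u with hU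
  have hpi : (2 * Real.pi)⁻¹ ≠ 0 := by positivity
  set g : (ℝ × ℝ) ≃L[ℝ] WithLp 2 (ℝ × ℝ) :=
    (ContinuousLinearEquiv.smulLeft (Units.mk0 _ hpi)).trans e.symm with hg
  have hgk : ∀ k, g k = WithLp.toLp 2 ((2 * Real.pi)⁻¹ • k) := fun k => rfl
  refine ⟨SchwartzMap.compCLMOfContinuousLinearEquiv ℂ g (𝓕 U), fun k => ?_, fun p => ?_⟩
  · change _ = 𝓕 (U : WithLp 2 (ℝ × ℝ) → ℂ) (g k)
    rw [Real.fourier_eq', ← integral_comp_toLp, FT2]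
    refine integral_congr_ae (.of_forall fun p => ?_)
    simp only [smul_eq_mul]
    change _ = _ * u p
    congr 2
    rw [hgk, WithLp.prod_inner_apply]
    simp only [Prod.smul_fst, Prod.smul_snd, smul_eq_mul, RCLike.inner_apply, conj_trivial]
    push_cast
    have : (Real.pi : ℂ) ≠ 0 := by exact_mod_cast Real.pi_ne_zero
    field_simp
  · have h1 : u p = 𝓕⁻ (𝓕 U) (WithLp.toLp 2 p) := by
      rw [FourierTransform.fourierInv_fourier_eq]; rfl
    rw [h1, SchwartzMap.fourierInv_coe, Real.fourierInv_eq', ← integral_comp_toLp]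
    have h2 := Measure.integral_comp_smul (volume : Measure (ℝ × ℝ)) (fun w : ℝ × ℝ =>
      Complex.exp ((2 * Real.pi * inner ℝ (WithLp.toLp 2 w) (WithLp.toLp 2 p) : ℝ) * Complex.I) •
        (𝓕 U) (WithLp.toLp 2 w)) (2 * Real.pi)⁻¹
    have h3 : Module.finrank ℝ (ℝ × ℝ) = 2 := by simp
    rw [h3, inv_pow, inv_inv, abs_of_pos (by positivity)] at h2
    have h4 : (∫ k : ℝ × ℝ, Complex.exp (Complex.I * ((p.1 * k.1 + p.2 * k.2 : ℝ) : ℂ)) *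
        SchwartzMap.compCLMOfContinuousLinearEquiv ℂ g (𝓕 U) k) =
        ∫ k : ℝ × ℝ, Complex.exp ((2 * Real.pi * inner ℝ (WithLp.toLp 2 ((2 * Real.pi)⁻¹ • k))
          (WithLp.toLp 2 p) : ℝ) * Complex.I) •
        (𝓕 U) (WithLp.toLp 2 ((2 * Real.pi)⁻¹ • k)) := by
      refine integral_congr_ae (.of_forall fun k => ?_)
      simp only [smul_eq_mul]
      change _ * (𝓕 U) (g k) = _
      rw [hgk, WithLp.prod_inner_apply]
      congr 2
      simp only [Prod.smul_fst, Prod.smul_snd, smul_eq_mul, RCLike.inner_apply, conj_trivial]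
      push_cast
      have : (Real.pi : ℂ) ≠ 0 := by exact_mod_cast Real.pi_ne_zero
      field_simp
    rw [h4, h2, Complex.real_smul, ← mul_assoc, ← Complex.ofReal_mul,
      inv_mul_cancel₀ (by positivity), Complex.ofReal_one, one_mul]

lemma FT2_mul_eq_integral (u : SchwartzMap (ℝ × ℝ) ℂ) {w : ℝ × ℝ → ℂ} (hw : Integrable w)
    (q : ℝ × ℝ) :
    FT2 (fun p => u p * w p) q.1 q.2 = ∫ k : ℝ × ℝ, ((((2 * Real.pi) ^ 2)⁻¹ : ℝ) : ℂ) *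
      (FT2 u k.1 k.2 * FT2 w (q - k).1 (q - k).2) := by
  obtain ⟨v, hv, huv⟩ := exists_schwartzMap_eq_FT2 u
  set c : ℂ := ((((2 * Real.pi) ^ 2)⁻¹ : ℝ) : ℂ)
  set F : ℝ × ℝ → ℝ × ℝ → ℂ := fun p k =>
    c * (v k * (Complex.exp (-(Complex.I * ((p.1 * (q - k).1 + p.2 * (q - k).2 : ℝ) : ℂ))) * w p))
    with hF
  have hFint : Integrable (Function.uncurry F) (volume.prod volume) := by
    have h0 : Integrable (fun z : (ℝ × ℝ) × (ℝ × ℝ) => c * (w z.1 * v z.2))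
        (volume.prod volume) := (hw.mul_prod v.integrable).const_mul c
    have h1 : Integrable (fun z : (ℝ × ℝ) × (ℝ × ℝ) => Complex.exp (-(Complex.I *
        ((z.1.1 * (q - z.2).1 + z.1.2 * (q - z.2).2 : ℝ) : ℂ))) * (c * (w z.1 * v z.2)))
        (volume.prod volume) := by
      refine h0.bdd_mul (c := 1) (Continuous.aestronglyMeasurable (by fun_prop))
        (.of_forall fun z => ?_)
      rw [← mul_neg, mul_comm, ← Complex.ofReal_neg,
        Complex.norm_exp_ofReal_mul_I]
    refine h1.congr (.of_forall fun z => ?_)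
    simp only [Function.uncurry, hF]
    ring
  calc FT2 (fun p => u p * w p) q.1 q.2 = ∫ p, ∫ k, F p k := by
        unfold FT2
        refine integral_congr_ae (.of_forall fun p => ?_)
        simp only [huv p, hF]
        rw [← integral_const_mul, ← integral_mul_const, ← integral_const_mul]
        refine integral_congr_ae (.of_forall fun k => ?_)
        simp only []
        have : Complex.exp (-(Complex.I * ((p.1 * (q - k).1 + p.2 * (q - k).2 : ℝ) : ℂ))) =
            Complex.exp (-(Complex.I * ((p.1 * q.1 + p.2 * q.2 : ℝ) : ℂ))) *
            Complex.exp (Complex.I * ((p.1 * k.1 + p.2 * k.2 : ℝ) : ℂ)) := by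
          rw [← Complex.exp_add]
          congr 1
          simp only [Prod.fst_sub, Prod.snd_sub]
          push_cast
          ring
        rw [this]
        ring
    _ = ∫ k, ∫ p, F p k := integral_integral_swap hFint
    _ = _ := by
        refine integral_congr_ae (.of_forall fun k => ?_)
        simp only [hF, hv k]
        rw [integral_const_mul, integral_const_mul]
        rfl

lemma enorm_FT2_mul_le (u : SchwartzMap (ℝ × ℝ) ℂ) {w : ℝ × ℝ → ℂ} (hw : Integrable w)
    (q : ℝ × ℝ) :
    ‖FT2 (fun p => u p * w p) q.1 q.2‖ₑ ≤ ENNReal.ofReal (((2 * Real.pi) ^ 2)⁻¹) *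
      ∫⁻ k : ℝ × ℝ, ‖FT2 u k.1 k.2‖ₑ * ‖FT2 w (q - k).1 (q - k).2‖ₑ := by
  rw [FT2_mul_eq_integral u hw]
  refine (enorm_integral_le_lintegral_enorm _).trans (le_of_eq ?_)
  rw [← lintegral_const_mul' _ _ ENNReal.ofReal_ne_top]
  refine lintegral_congr fun k => ?_
  rw [enorm_mul, enorm_mul, ← ofReal_norm (E := ℂ) (((((2 * Real.pi) ^ 2)⁻¹ : ℝ) : ℂ)),
    Complex.norm_real, Real.norm_of_nonneg (by positivity)]

lemma exists_schwartzMap_eq_mul (u w : SchwartzMap (ℝ × ℝ) ℂ) :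
    ∃ v : SchwartzMap (ℝ × ℝ) ℂ, ⇑v = fun p => u p * w p :=
  ⟨SchwartzMap.pairing (ContinuousLinearMap.mul ℂ ℂ) u w, rfl⟩

lemma measurable_FT2 (u : SchwartzMap (ℝ × ℝ) ℂ) : Measurable fun k : ℝ × ℝ => FT2 u k.1 k.2 := by
  obtain ⟨v, hv, -⟩ := exists_schwartzMap_eq_FT2 u
  simp only [hv]
  exact v.continuous.measurable

lemma enorm_FT2_quartic_le (u₁ u₂ u₃ u₄ : SchwartzMap (ℝ × ℝ) ℂ) (a : ℝ × ℝ) :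
    ‖FT2 (fun p => u₁ p * u₂ p * u₃ p * u₄ p) (-a).1 (-a).2‖ₑ ≤
      ENNReal.ofReal (((2 * Real.pi) ^ 2)⁻¹) ^ 3 * ∫⁻ κ : ℝ × ℝ, ∫⁻ p : ℝ × ℝ, ∫⁻ q : ℝ × ℝ,
        ‖FT2 u₁ p.1 p.2‖ₑ * ‖FT2 u₂ q.1 q.2‖ₑ *
        ‖FT2 u₃ (-κ - p - q).1 (-κ - p - q).2‖ₑ * ‖FT2 u₄ (κ - a).1 (κ - a).2‖ₑ := by
  set c := ENNReal.ofReal (((2 * Real.pi) ^ 2)⁻¹) with hc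
  have hct : c ≠ ⊤ := ENNReal.ofReal_ne_top
  obtain ⟨w, hw⟩ := exists_schwartzMap_eq_mul u₂ u₃
  obtain ⟨y, hy⟩ := exists_schwartzMap_eq_mul u₁ w
  have e : (fun p => u₁ p * u₂ p * u₃ p * u₄ p) = fun p => u₄ p * y p := by
    funext p; rw [hy]; simp only [hw]; ring
  have hwk : ∀ k, ‖FT2 w k.1 k.2‖ₑ ≤ c * ∫⁻ q : ℝ × ℝ, ‖FT2 u₂ q.1 q.2‖ₑ *
      ‖FT2 u₃ (k - q).1 (k - q).2‖ₑ := fun k => by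
    rw [hw]; exact enorm_FT2_mul_le u₂ u₃.integrable k
  have hyk : ∀ k, ‖FT2 y k.1 k.2‖ₑ ≤ c ^ 2 * ∫⁻ p : ℝ × ℝ, ∫⁻ q : ℝ × ℝ, ‖FT2 u₁ p.1 p.2‖ₑ *
      ‖FT2 u₂ q.1 q.2‖ₑ * ‖FT2 u₃ (k - p - q).1 (k - p - q).2‖ₑ := fun k => by
    rw [hy]
    refine (enorm_FT2_mul_le u₁ w.integrable k).trans ?_
    rw [pow_two c, mul_assoc]
    refine mul_le_mul' le_rfl ?_
    rw [← lintegral_const_mul' _ _ hct]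
    refine lintegral_mono fun p => ?_
    refine (mul_le_mul' le_rfl (hwk (k - p))).trans (le_of_eq ?_)
    rw [mul_left_comm, ← lintegral_const_mul' _ _ enorm_ne_top]
    simp only [mul_assoc]
  rw [e]
  refine (enorm_FT2_mul_le u₄ y.integrable (-a)).trans ?_
  rw [← lintegral_sub_right_eq_self _ a, pow_succ' c 2, mul_assoc]
  refine mul_le_mul' le_rfl ?_
  rw [← lintegral_const_mul' _ _ (ENNReal.pow_ne_top hct)]
  refine lintegral_mono fun κ => ?_
  have e2 : -a - (κ - a) = -κ := by abel
  simp only [e2]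
  refine (mul_le_mul' le_rfl (hyk (-κ))).trans (le_of_eq ?_)
  rw [mul_left_comm]
  congr 1
  rw [← lintegral_const_mul' _ _ enorm_ne_top]
  refine lintegral_congr fun p => ?_
  rw [← lintegral_const_mul' _ _ enorm_ne_top]
  refine lintegral_congr fun q => ?_
  ring

lemma integrable_wgt_mul_norm_FT2_sq {b : ℝ} (hb : b ≤ 1) (u : SchwartzMap (ℝ × ℝ) ℂ) :
    Integrable fun k : ℝ × ℝ => wgt 0 b k.1 k.2 * ‖FT2 u k.1 k.2‖ ^ 2 := by
  obtain ⟨v, hv, -⟩ := exists_schwartzMap_eq_FT2 u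
  have ht : Function.HasTemperateGrowth fun k : ℝ × ℝ => 1 + (k.1 - k.2 ^ 3) ^ 2 := by
    have h₁ : Function.HasTemperateGrowth fun k : ℝ × ℝ => k.1 :=
      (ContinuousLinearMap.fst ℝ ℝ ℝ).hasTemperateGrowth
    have h₂ : Function.HasTemperateGrowth fun k : ℝ × ℝ => k.2 :=
      (ContinuousLinearMap.snd ℝ ℝ ℝ).hasTemperateGrowth
    fun_prop
  obtain ⟨y, hy⟩ := exists_schwartzMap_eq_mul (SchwartzMap.smulLeftCLM ℂ
    (fun k : ℝ × ℝ => 1 + (k.1 - k.2 ^ 3) ^ 2) v) v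
  simp only [hv]
  have hm : Measurable fun k : ℝ × ℝ => wgt 0 b k.1 k.2 * ‖v k‖ ^ 2 := by
    unfold wgt
    have := v.continuous.measurable
    fun_prop
  refine y.integrable.mono hm.aestronglyMeasurable (.of_forall fun k => ?_)
  have h1 : 1 ≤ 1 + (k.1 - k.2 ^ 3) ^ 2 := by nlinarith [sq_nonneg (k.1 - k.2 ^ 3)]
  have h2 : 0 ≤ wgt 0 b k.1 k.2 := by unfold wgt; positivity
  rw [hy, Real.norm_of_nonneg (by positivity)]
  simp only []
  rw [SchwartzMap.smulLeftCLM_apply_apply ht,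
    norm_mul, norm_smul, Real.norm_of_nonneg (by positivity), mul_assoc, ← sq]
  gcongr
  rw [wgt, Real.rpow_zero, one_mul]
  exact (Real.rpow_le_rpow_of_exponent_le h1 hb).trans (by rw [Real.rpow_one])

lemma lintegral_sq_eq_Xnorm_sq {b : ℝ} (hb : b ≤ 1) (u : SchwartzMap (ℝ × ℝ) ℂ) :
    ∫⁻ k : ℝ × ℝ, (ENNReal.ofReal ((1 + (k.1 - k.2 ^ 3) ^ 2) ^ (b / 2)) *
      ‖FT2 u k.1 k.2‖ₑ) ^ 2 = ENNReal.ofReal (Xnorm 0 b u ^ 2) := by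
  have h0 : ∀ k : ℝ × ℝ, 0 ≤ wgt 0 b k.1 k.2 * ‖FT2 u k.1 k.2‖ ^ 2 := fun k => by
    unfold wgt; positivity
  rw [Xnorm, Real.sq_sqrt (integral_nonneg h0), ofReal_integral_eq_lintegral_ofReal
    (integrable_wgt_mul_norm_FT2_sq hb u) (.of_forall h0)]
  refine lintegral_congr fun k => ?_
  rw [mul_pow, ofReal_rpow_half_sq (by positivity), ENNReal.ofReal_mul (by unfold wgt; positivity),
    wgt, Real.rpow_zero, one_mul, ENNReal.ofReal_pow (norm_nonneg _), ofReal_norm]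

/-- The part of `smoothingWeight` carried by the output frequency. -/
def outputWeight (σ : ℝ) (k : ℝ × ℝ) : ENNReal :=
  ENNReal.ofReal (|k.2| * (1 + k.2 ^ 2) ^ (σ / 2) *
    (1 + (k.1 - k.2 ^ 3) ^ 2) ^ ((-1 / 2 + 2 * ((1 / 2 - σ) / 18)) / 2))

@[fun_prop]
lemma measurable_outputWeight (σ : ℝ) : Measurable (outputWeight σ) := by
  unfold outputWeight; fun_prop

lemma outputWeight_neg (σ : ℝ) (k : ℝ × ℝ) : outputWeight σ (-k) = outputWeight σ k := by
  unfold outputWeight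
  simp only [Prod.fst_neg, Prod.snd_neg, abs_neg, neg_sq]
  rw [show (-k.1 - (-k.2) ^ 3) ^ 2 = (k.1 - k.2 ^ 3) ^ 2 by ring]

lemma integral_wgt_eq_toReal_lintegral {σ : ℝ} {F : ℝ × ℝ → ℂ} (hF : Measurable F) :
    ∫ q : ℝ × ℝ, wgt σ (-1 / 2 + 2 * ((1 / 2 - σ) / 18)) q.1 q.2 * (|q.2| * ‖F q‖) ^ 2 =
      (∫⁻ q : ℝ × ℝ, (outputWeight σ q * ‖F q‖ₑ) ^ 2).toReal := by
  rw [integral_eq_lintegral_of_nonneg_ae (.of_forall fun q => by unfold wgt; positivity)]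
  · congr 1
    refine lintegral_congr fun q => ?_
    rw [← ofReal_norm, outputWeight, ← ENNReal.ofReal_mul (by positivity),
      ← ENNReal.ofReal_pow (by positivity), mul_pow, mul_pow, mul_pow, mul_pow, wgt,
      ← Real.rpow_mul_natCast (by positivity), ← Real.rpow_mul_natCast (by positivity)]
    congr 1
    push_cast
    rw [div_mul_cancel₀ _ (by norm_num), div_mul_cancel₀ _ (by norm_num)]
    ring
  · unfold wgt
    exact Measurable.aestronglyMeasurable (by fun_prop)

lemma smoothingWeight_mul_prod_eq {σ : ℝ} {g : ℝ × ℝ → ENNReal} {v : Fin 4 → ℝ × ℝ → ENNReal}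
    (k : Fin 5 → ℝ × ℝ) :
    smoothingWeight σ k * ∏ j, (Fin.cons g fun (j : Fin 4) (k : ℝ × ℝ) =>
      ENNReal.ofReal ((1 + (k.1 - k.2 ^ 3) ^ 2) ^ ((1 / 2 + (1 / 2 - σ) / 18) / 2)) * v j k :
      Fin 5 → ℝ × ℝ → ENNReal) j (k j) =
      g (k 0) * outputWeight σ (k 0) * ∏ j : Fin 4, v j (k j.succ) := by
  rw [Fin.prod_univ_succ]
  simp only [Fin.cons_zero, Fin.cons_succ]
  have h : ∀ k : ℝ × ℝ, ∀ a, modulation ((1 / 2 + (1 / 2 - σ) / 18) / 2) k *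
      (ENNReal.ofReal ((1 + (k.1 - k.2 ^ 3) ^ 2) ^ ((1 / 2 + (1 / 2 - σ) / 18) / 2)) * a) = a :=
    fun k a => by
    rw [modulation, japanese, ← mul_assoc, ← ENNReal.ofReal_mul (by positivity),
      ← Real.rpow_add (by positivity), neg_add_cancel, Real.rpow_zero, ENNReal.ofReal_one, one_mul]
  unfold smoothingWeight
  rw [mul_mul_mul_comm, ← Finset.prod_mul_distrib]
  simp only [h]
  rw [mul_comm (g _)]
  rfl

lemma lintegral_mul_le_zeroSumIntegral {W G v₁ v₂ v₃ v₄ : ℝ × ℝ → ENNReal} {c : ENNReal}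
    (hW : Measurable W) (m₁ : Measurable v₁) (m₂ : Measurable v₂) (m₃ : Measurable v₃)
    (m₄ : Measurable v₄) (hc : c ≠ ⊤)
    (hG : ∀ a, G a ≤ c * ∫⁻ κ, ∫⁻ p, ∫⁻ q, v₁ p * v₂ q * v₃ (-κ - p - q) * v₄ (κ - a)) :
    ∫⁻ a, W a * G a ≤ c * zeroSumIntegral fun k =>
      W (k 0) * (v₁ (k 1) * v₂ (k 2) * v₃ (k 3) * v₄ (k 4)) := by
  rw [zeroSumIntegral_eq (by fun_prop)]
  change _ ≤ c * ∫⁻ κ, ∫⁻ a, ∫⁻ p, ∫⁻ q, W a * (v₁ p * v₂ q * v₃ (-κ - p - q) * v₄ (κ - a))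
  have hm : Measurable fun z : (((ℝ × ℝ) × (ℝ × ℝ)) × (ℝ × ℝ)) × (ℝ × ℝ) => W z.1.1.2 *
        (v₁ z.1.2 * v₂ z.2 * v₃ (-z.1.1.1 - z.1.2 - z.2) * v₄ (z.1.1.1 - z.1.1.2)) := by
    fun_prop
  have hm' : Measurable fun z : (ℝ × ℝ) × (ℝ × ℝ) => ∫⁻ p, ∫⁻ q, W z.2 *
        (v₁ p * v₂ q * v₃ (-z.1 - p - q) * v₄ (z.1 - z.2)) := by
    have : Measurable fun z : ((ℝ × ℝ) × (ℝ × ℝ)) × (ℝ × ℝ) => ∫⁻ q, W z.1.2 *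
        (v₁ z.2 * v₂ q * v₃ (-z.1.1 - z.2 - q) * v₄ (z.1.1 - z.1.2)) :=
      hm.lintegral_prod_right'
    exact this.lintegral_prod_right'
  rw [lintegral_lintegral_swap hm'.aemeasurable, ← lintegral_const_mul' _ _ hc]
  refine lintegral_mono fun a => ?_
  have n₀ : Measurable fun z : ((ℝ × ℝ) × (ℝ × ℝ)) × (ℝ × ℝ) =>
      v₁ z.1.2 * v₂ z.2 * v₃ (-z.1.1 - z.1.2 - z.2) * v₄ (z.1.1 - a) := by fun_prop
  have n₁ : Measurable fun z : (ℝ × ℝ) × (ℝ × ℝ) => ∫⁻ q, v₁ z.2 * v₂ q * v₃ (-z.1 - z.2 - q) *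
      v₄ (z.1 - a) := n₀.lintegral_prod_right'
  have n₂ : Measurable fun κ => ∫⁻ p, ∫⁻ q, v₁ p * v₂ q * v₃ (-κ - p - q) * v₄ (κ - a) :=
    n₁.lintegral_prod_right'
  refine (mul_le_mul' le_rfl (hG a)).trans (le_of_eq ?_)
  rw [mul_left_comm]
  congr 1
  rw [← lintegral_const_mul _ n₂]
  refine lintegral_congr fun κ => ?_
  have n₃ : Measurable fun p => ∫⁻ q, v₁ p * v₂ q * v₃ (-κ - p - q) * v₄ (κ - a) :=
    n₁.comp measurable_prodMk_left
  rw [← lintegral_const_mul _ n₃]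
  refine lintegral_congr fun p => ?_
  have n₄ : Measurable fun q => v₁ p * v₂ q * v₃ (-κ - p - q) * v₄ (κ - a) := by fun_prop
  rw [← lintegral_const_mul _ n₄]

theorem quartic_nonlinear_smoothing (σ : ℝ) (hσ0 : 0 < σ) (hσ : σ < 1/2) :
    ∃ b b' C : ℝ, 1/2 < b ∧ b < 1 ∧ b - 1 < b' ∧ b' < 0 ∧ 0 < C ∧
      ∀ u₁ u₂ u₃ u₄ : SchwartzMap (ℝ × ℝ) ℂ,
        Real.sqrt (∫ q : ℝ × ℝ, wgt σ b' q.1 q.2 *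
            (|q.2| * ‖FT2 (fun p => u₁ p * u₂ p * u₃ p * u₄ p) q.1 q.2‖) ^ 2) ≤
          C * (Xnorm 0 b ⇑u₁ * Xnorm 0 b ⇑u₂ * Xnorm 0 b ⇑u₃ * Xnorm 0 b ⇑u₄) := by
  obtain ⟨C, hC, hbound⟩ := exists_quintilinearBound_smoothingWeight hσ0 hσ
  set c := ENNReal.ofReal (((2 * Real.pi) ^ 2)⁻¹) ^ 3 with hc
  have hct : c < ⊤ := ENNReal.pow_lt_top ENNReal.ofReal_lt_top
  have hK : c ^ 2 * C ≠ ⊤ := (ENNReal.mul_lt_top (ENNReal.pow_lt_top hct) hC).ne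
  refine ⟨1 / 2 + (1 / 2 - σ) / 18, -1 / 2 + 2 * ((1 / 2 - σ) / 18),
    Real.sqrt (c ^ 2 * C).toReal + 1, by linarith, by linarith, by linarith, by linarith,
    by positivity, fun u₁ u₂ u₃ u₄ => ?_⟩
  have hb : 1 / 2 + (1 / 2 - σ) / 18 ≤ 1 := by linarith
  have hF : Measurable fun q : ℝ × ℝ => FT2 (fun p => u₁ p * u₂ p * u₃ p * u₄ p) q.1 q.2 := by
    obtain ⟨w, hw⟩ := exists_schwartzMap_eq_mul u₁ u₂
    obtain ⟨y, hy⟩ := exists_schwartzMap_eq_mul w u₃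
    obtain ⟨z, hz⟩ := exists_schwartzMap_eq_mul y u₄
    have := measurable_FT2 z
    simpa only [hz, hy, hw] using this
  rw [integral_wgt_eq_toReal_lintegral hF]
  set F : ℝ × ℝ → ℂ := fun q => FT2 (fun p => u₁ p * u₂ p * u₃ p * u₄ p) q.1 q.2 with hF_def
  set g : ℝ × ℝ → ENNReal := fun a => outputWeight σ (-a) * ‖F (-a)‖ₑ with hg_def
  have hg : Measurable g := by fun_prop
  have hX : ∫⁻ q, (outputWeight σ q * ‖F q‖ₑ) ^ 2 = ∫⁻ a, g a ^ 2 :=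
    (lintegral_neg_eq_self (μ := volume) fun q => (outputWeight σ q * ‖F q‖ₑ) ^ 2).symm
  change Real.sqrt (∫⁻ q, (outputWeight σ q * ‖F q‖ₑ) ^ 2).toReal ≤ _
  rw [hX]
  set X := ∫⁻ a, g a ^ 2 with hX_def
  set N := Xnorm 0 (1 / 2 + (1 / 2 - σ) / 18) u₁ * Xnorm 0 (1 / 2 + (1 / 2 - σ) / 18) u₂ *
    Xnorm 0 (1 / 2 + (1 / 2 - σ) / 18) u₃ * Xnorm 0 (1 / 2 + (1 / 2 - σ) / 18) u₄ with hN
  have hN0 : 0 ≤ N := by unfold N Xnorm; positivity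
  set v : Fin 4 → ℝ × ℝ → ENNReal := ![fun k => ‖FT2 u₁ k.1 k.2‖ₑ, fun k => ‖FT2 u₂ k.1 k.2‖ₑ,
    fun k => ‖FT2 u₃ k.1 k.2‖ₑ, fun k => ‖FT2 u₄ k.1 k.2‖ₑ] with hv
  have hvm : ∀ j, Measurable (v j) := by
    intro j
    fin_cases j
    exacts [(measurable_FT2 u₁).enorm, (measurable_FT2 u₂).enorm, (measurable_FT2 u₃).enorm,
      (measurable_FT2 u₄).enorm]
  set f : Fin 5 → ℝ × ℝ → ENNReal := Fin.cons g fun (j : Fin 4) (k : ℝ × ℝ) =>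
    ENNReal.ofReal ((1 + (k.1 - k.2 ^ 3) ^ 2) ^ ((1 / 2 + (1 / 2 - σ) / 18) / 2)) * v j k with hf
  have hfm : ∀ j, Measurable (f j) := by
    intro j
    refine Fin.cases hg (fun i => ?_) j
    have := hvm i
    simp only [hf, Fin.cons_succ]
    fun_prop
  have hX1 : X ≤ c * zeroSumIntegral fun k => smoothingWeight σ k * ∏ j, f j (k j) := by
    simp only [hf, smoothingWeight_mul_prod_eq]
    have h := lintegral_mul_le_zeroSumIntegral (W := fun a => g a * outputWeight σ a) (by fun_prop)
      (hvm 0) (hvm 1) (hvm 2) (hvm 3) hct.ne (enorm_FT2_quartic_le u₁ u₂ u₃ u₄)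
    simp only [Fin.prod_univ_four]
    refine le_trans (le_of_eq ?_) h
    refine lintegral_congr fun a => ?_
    rw [sq, ← outputWeight_neg σ a]
    exact (mul_assoc _ _ _).symm
  have hprod : ∏ j, ∫⁻ a, f j a ^ 2 = X * ENNReal.ofReal (N ^ 2) := by
    rw [Fin.prod_univ_succ, Fin.prod_univ_four]
    change X * (_ * _ * _ * _) = _
    congr 1
    rw [hN, mul_pow, mul_pow, mul_pow, ENNReal.ofReal_mul (by positivity),
      ENNReal.ofReal_mul (by positivity), ENNReal.ofReal_mul (by positivity),
      ← lintegral_sq_eq_Xnorm_sq hb, ← lintegral_sq_eq_Xnorm_sq hb, ← lintegral_sq_eq_Xnorm_sq hb,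
      ← lintegral_sq_eq_Xnorm_sq hb]
    rfl
  have hX2 : X * X ≤ X * (c ^ 2 * C * ENNReal.ofReal (N ^ 2)) := by
    calc X * X = X ^ 2 := (sq X).symm
      _ ≤ c ^ 2 * (C * (X * ENNReal.ofReal (N ^ 2))) := by
          rw [← hprod]
          refine (pow_le_pow_left' hX1 2).trans ?_
          rw [mul_pow]
          exact mul_le_mul' le_rfl (hbound f hfm)
      _ = _ := by ring
  have hfin : X.toReal ≤ (c ^ 2 * C).toReal * N ^ 2 := by
    rcases eq_or_ne X 0 with h0 | h0
    · rw [h0]; simp; positivity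
    rcases eq_or_ne X ⊤ with ht | ht
    · rw [ht]; simp; positivity
    have h3 := (ENNReal.mul_le_mul_iff_right h0 ht).1 hX2
    have h4 := ENNReal.toReal_mono (ENNReal.mul_ne_top hK ENNReal.ofReal_ne_top) h3
    rwa [ENNReal.toReal_mul, ENNReal.toReal_ofReal (by positivity)] at h4
  calc Real.sqrt X.toReal ≤ Real.sqrt ((c ^ 2 * C).toReal * N ^ 2) := Real.sqrt_le_sqrt hfin
    _ = Real.sqrt (c ^ 2 * C).toReal * N := by
        rw [Real.sqrt_mul ENNReal.toReal_nonneg, Real.sqrt_sq hN0]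
    _ ≤ _ := by gcongr; linarith

end
end

section
/- Let −1/6 < s < 0, N ≥ 1, and σ ∈ [−3s, 1/2]. Then for every (ξ₁,…,ξ₅) ∈ ℝ⁵ with ξ₁+ξ₂+ξ₃+ξ₄+ξ₅ = 0, | m(ξ₁)²ξ₁ + m(ξ₂)²ξ₂ + m(ξ₃)²ξ₃ + m(ξ₄)²ξ₄ + m(ξ₅)²ξ₅ | / ( m(ξ₁)m(ξ₂)m(ξ₃)m(ξ₄)m(ξ₅) ) ≤ 5 · max_{j=1,…,5} ( |ξ_j| ⟨ξ_j⟩^{σ} ) / N^{σ}. -/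
noncomputable section

/-- The I-method multiplier m. -/
def mI (s N ξ : ℝ) : ℝ := if |ξ| ≤ N then 1 else (|ξ| / N) ^ s

theorem mI_of_le {s N ξ : ℝ} (h : |ξ| ≤ N) : mI s N ξ = 1 := if_pos h

theorem mI_of_lt {s N ξ : ℝ} (h : N < |ξ|) : mI s N ξ = (|ξ| / N) ^ s := if_neg h.not_ge

theorem mI_pos {N : ℝ} (hN : 0 < N) (s ξ : ℝ) : 0 < mI s N ξ := by
  rcases le_or_gt |ξ| N with h | h
  · simp [mI_of_le h]
  · have := hN.trans h
    rw [mI_of_lt h]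
    positivity

theorem mI_le_mI {s N x y : ℝ} (hs : s ≤ 0) (hN : 0 < N) (h : |x| ≤ |y|) :
    mI s N y ≤ mI s N x := by
  rcases le_or_gt |y| N with hy | hy
  · rw [mI_of_le hy, mI_of_le (h.trans hy)]
  · rw [mI_of_lt hy]
    rcases le_or_gt |x| N with hx | hx
    · rw [mI_of_le hx]
      exact Real.rpow_le_one_of_one_le_of_nonpos ((one_le_div hN).2 hy.le) hs
    · rw [mI_of_lt hx]
      have := hN.trans hx
      exact Real.rpow_le_rpow_of_nonpos (by positivity) (by gcongr) hs

theorem mI_sq_mul_abs_of_lt {s N x : ℝ} (hN : 0 < N) (h : N < |x|) :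
    mI s N x ^ 2 * |x| = N * (|x| / N) ^ (1 + 2 * s) := by
  have hx : 0 < |x| / N := div_pos (hN.trans h) hN
  rw [mI_of_lt h, Real.rpow_add hx, Real.rpow_one, mul_comm 2 s, Real.rpow_mul hx.le,
    Real.rpow_two]
  field_simp

theorem mI_sq_mul_abs_le {s N x y : ℝ} (hs : -1 / 2 ≤ s) (hN : 0 < N) (h : |x| ≤ |y|) :
    mI s N x ^ 2 * |x| ≤ mI s N y ^ 2 * |y| := by
  have hs' : 0 ≤ 1 + 2 * s := by linarith
  rcases le_or_gt |y| N with hy | hy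
  · simpa [mI_of_le hy, mI_of_le (h.trans hy)] using h
  · rw [mI_sq_mul_abs_of_lt hN hy]
    rcases le_or_gt |x| N with hx | hx
    · rw [mI_of_le hx, one_pow, one_mul]
      exact hx.trans (le_mul_of_one_le_right hN.le
        (Real.one_le_rpow ((one_le_div hN).2 hy.le) hs'))
    · rw [mI_sq_mul_abs_of_lt hN hx]
      gcongr

theorem abs_rpow_le_one_add_sq_rpow {σ : ℝ} (hσ : 0 ≤ σ) (x : ℝ) :
    |x| ^ σ ≤ (1 + x ^ 2) ^ (σ / 2) := by
  have h : |x| ^ σ = (x ^ 2) ^ (σ / 2) := by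
    rw [← sq_abs x, ← Real.rpow_two, ← Real.rpow_mul (abs_nonneg x)]
    congr 1
    ring
  rw [h]
  gcongr
  linarith

theorem pointwise_multiplier_estimate
    (s : ℝ) (hs : -1/6 < s) (hs0 : s < 0) (N : ℝ) (hN : 1 ≤ N)
    (σ : ℝ) (hσ1 : -3 * s ≤ σ) (hσ2 : σ ≤ 1/2)
    (ξ : Fin 5 → ℝ) (hsum : ∑ j, ξ j = 0) :
    |∑ j, mI s N (ξ j) ^ 2 * ξ j| / ∏ j, mI s N (ξ j) ≤
      5 * (Finset.univ.sup' Finset.univ_nonempty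
          fun j => |ξ j| * (1 + (ξ j) ^ 2) ^ (σ / 2)) / N ^ σ := by
  have hN0 : 0 < N := by linarith
  obtain ⟨k, -, hk⟩ := Finset.exists_max_image Finset.univ (fun j => |ξ j|) Finset.univ_nonempty
  replace hk : ∀ j, |ξ j| ≤ |ξ k| := fun j => hk j (Finset.mem_univ j)
  have hsup : |ξ k| * (1 + ξ k ^ 2) ^ (σ / 2) ≤ Finset.univ.sup' Finset.univ_nonempty
      fun j => |ξ j| * (1 + (ξ j) ^ 2) ^ (σ / 2) :=
    Finset.le_sup' (fun j => |ξ j| * (1 + (ξ j) ^ 2) ^ (σ / 2)) (Finset.mem_univ k)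
  refine le_trans ?_ (show 5 * (|ξ k| * (1 + ξ k ^ 2) ^ (σ / 2)) / N ^ σ ≤ _ by gcongr)
  rcases le_or_gt |ξ k| N with h | h
  · simp only [fun j => mI_of_le (s := s) ((hk j).trans h), one_pow, one_mul, hsum, abs_zero,
      zero_div]
    positivity
  have hm := mI_pos hN0 s (ξ k)
  have hnum : |∑ j, mI s N (ξ j) ^ 2 * ξ j| ≤ 5 * (mI s N (ξ k) ^ 2 * |ξ k|) := by
    refine (Finset.abs_sum_le_sum_abs _ _).trans
      ((Finset.sum_le_card_nsmul _ _ (mI s N (ξ k) ^ 2 * |ξ k|) fun j _ => ?_).trans_eq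
        (by simp))
    rw [abs_mul, abs_of_nonneg (sq_nonneg _)]
    exact mI_sq_mul_abs_le (by linarith) hN0 (hk j)
  have hden : mI s N (ξ k) ^ 5 ≤ ∏ j, mI s N (ξ j) := by
    simpa using Finset.prod_le_prod (s := Finset.univ) (f := fun _ : Fin 5 => mI s N (ξ k))
      (fun _ _ => hm.le) fun j _ => mI_le_mI hs0.le hN0 (hk j)
  have ha : 1 ≤ |ξ k| / N := (one_le_div hN0).2 h.le
  have hinv : (mI s N (ξ k) ^ 3)⁻¹ ≤ |ξ k| ^ σ / N ^ σ := by
    rw [← Real.div_rpow (abs_nonneg _) hN0.le, mI_of_lt h, ← Real.rpow_mul_natCast (by positivity),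
      ← Real.rpow_neg (by positivity)]
    exact Real.rpow_le_rpow_of_exponent_le ha (by push_cast; linarith)
  calc |∑ j, mI s N (ξ j) ^ 2 * ξ j| / ∏ j, mI s N (ξ j)
      ≤ 5 * (mI s N (ξ k) ^ 2 * |ξ k|) / mI s N (ξ k) ^ 5 := by gcongr
    _ = 5 * |ξ k| * (mI s N (ξ k) ^ 3)⁻¹ := by field_simp
    _ ≤ 5 * |ξ k| * (|ξ k| ^ σ / N ^ σ) := by gcongr
    _ = 5 * (|ξ k| * |ξ k| ^ σ) / N ^ σ := by ring
    _ ≤ 5 * (|ξ k| * (1 + ξ k ^ 2) ^ (σ / 2)) / N ^ σ := by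
      gcongr
      exact abs_rpow_le_one_add_sq_rpow (by linarith) _

end
end
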